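/- Product estimate in Gevrey–Sobolev spaces (Lemma 2.7): Let d ≥ 1, 1 < p < ∞, and let α, β satisfy 0 < α < d/p, 0 < β < d/p and α + β > d/p; set γ = α + β − d/p. Then there exists a constant C, depending only on d, p, α, β but NOT on a, such that for every a ≥ 0 and all Schwartz functions f, g on ℝ^d whose Fourier transforms are compactly supported: ‖G_{a,γ}(fg)‖_{L^p} ≤ C ‖G_{a,α} f‖_{L^p} ‖G_{a,β} g‖_{L^p}. -/

import Mathlib

open MeasureTheory SchwartzMap
open scoped ENNReal FourierTransform RealInnerProductSpace

/-- `G_{a,β} h (x) = ∫ e^{2πi⟨x,ξ⟩} e^{a‖ξ‖₁} ‖ξ‖^β 𝓕h(ξ) dξ`, where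
`‖ξ‖₁ = ∑ᵢ |ξᵢ|` and `𝓕h(ξ) = ∫ e^{−2πi⟨x,ξ⟩} h(x) dx`. -/
noncomputable def gev (d : ℕ) (a β : ℝ) (h : EuclideanSpace ℝ (Fin d) → ℂ) :
    EuclideanSpace ℝ (Fin d) → ℂ :=
  fun x => ∫ ξ : EuclideanSpace ℝ (Fin d),
    Complex.exp (((2 * Real.pi * ⟪x, ξ⟫) : ℝ) * Complex.I) *
      ((Real.exp (a * ∑ i, |ξ i|) * ‖ξ‖ ^ β : ℝ) : ℂ) * 𝓕 h ξ

theorem lintegral_rpow_rpow_inv_le_of_forall_lintegral_mul_le {X : Type*} [MeasurableSpace X]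
    {μ : Measure X} [SigmaFinite μ] {q r : ℝ} (hqr : q.HolderConjugate r) {u : X → ℝ≥0∞}
    (hu : Measurable u) {A : ℝ≥0∞}
    (h : ∀ G : X → ℝ≥0∞, Measurable G → ∫⁻ x, u x * G x ∂μ ≤ A * (∫⁻ x, G x ^ r ∂μ) ^ (1 / r)) :
    (∫⁻ x, u x ^ q ∂μ) ^ (1 / q) ≤ A := by
  have hq := hqr.pos
  have hr := hqr.symm.pos
  have hq1 := hqr.lt
  let v : ℕ → X → ℝ≥0∞ := fun n => (spanningSets μ n).indicator fun x => min (u x) n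
  have hv : ∀ n, Measurable (v n) := fun n =>
    (hu.min measurable_const).indicator (measurableSet_spanningSets μ n)
  have hvu : ∀ n x, v n x ≤ u x := fun n x =>
    (Set.indicator_le_self _ _ _).trans (min_le_left _ _)
  have hfin : ∀ n, ∫⁻ x, v n x ^ q ∂μ ≠ ∞ := by
    intro n
    have hle : ∀ x, v n x ^ q ≤ (spanningSets μ n).indicator (fun _ => (n : ℝ≥0∞) ^ q) x := by
      intro x
      by_cases hx : x ∈ spanningSets μ n
      · simp only [v, Set.indicator_of_mem hx]
        exact ENNReal.rpow_le_rpow (min_le_right _ _) hq.le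
      · simp [v, Set.indicator_of_notMem hx, hq]
    refine ((lintegral_mono hle).trans_lt ?_).ne
    rw [lintegral_indicator_const (measurableSet_spanningSets μ n)]
    exact ENNReal.mul_lt_top (ENNReal.rpow_lt_top_of_nonneg hq.le (ENNReal.natCast_ne_top n))
      (measure_spanningSets_lt_top μ n)
  have hbound : ∀ n, ∫⁻ x, v n x ^ q ∂μ ≤ A ^ q := by
    intro n
    set Y := ∫⁻ x, v n x ^ q ∂μ with hY
    have h1 : Y ≤ A * Y ^ (1 / r) := by
      have h2 := h (fun x => v n x ^ (q - 1)) ((hv n).pow_const _)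
      have h3 : ∀ x, (v n x ^ (q - 1)) ^ r = v n x ^ q := by
        intro x
        rw [← ENNReal.rpow_mul, hqr.sub_one_mul_conj]
      simp only [h3] at h2
      refine le_trans (lintegral_mono fun x => ?_) h2
      calc v n x ^ q = v n x ^ (1 + (q - 1)) := by ring_nf
        _ = v n x * v n x ^ (q - 1) := by
          rw [ENNReal.rpow_add_of_nonneg _ _ zero_le_one (by linarith), ENNReal.rpow_one]
        _ ≤ _ := mul_le_mul_left (hvu n x) _
    by_cases hY0 : Y = 0
    · simp [hY0]
    have hYr : Y ^ (1 / r) ≠ 0 := by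
      simp [hY0, hr.le]
    have hYr' : Y ^ (1 / r) ≠ ∞ := ENNReal.rpow_ne_top_of_nonneg (by positivity) (hfin n)
    have h4 : Y ^ (1 / q) ≤ A := by
      have : Y ^ (1 / q) * Y ^ (1 / r) ≤ A * Y ^ (1 / r) := by
        rw [← ENNReal.rpow_add _ _ hY0 (hfin n), one_div, one_div, hqr.inv_add_inv_eq_one,
          ENNReal.rpow_one]
        simpa only [one_div] using h1
      exact (ENNReal.mul_le_mul_iff_left hYr hYr').1 this
    calc Y = (Y ^ (1 / q)) ^ q := by rw [← ENNReal.rpow_mul]; simp [hq.ne']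
      _ ≤ A ^ q := ENNReal.rpow_le_rpow h4 hq.le
  have hmono : Monotone v := by
    intro m n hmn x
    refine (Set.indicator_le_indicator_of_subset (monotone_spanningSets μ hmn)
      (fun _ => zero_le) x).trans (Set.indicator_le_indicator ?_)
    exact min_le_min_left _ (by exact_mod_cast hmn)
  have hsup : ∀ x, u x ^ q ≤ ⨆ n, v n x ^ q := by
    intro x
    obtain ⟨N, hN⟩ : ∃ N, x ∈ spanningSets μ N := by
      have : x ∈ ⋃ n, spanningSets μ n := by rw [iUnion_spanningSets]; trivial
      exact Set.mem_iUnion.1 this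
    have h5 : ⨆ n : ℕ, min (u x) (n : ℝ≥0∞) ≤ ⨆ n, v n x := by
      refine iSup_le fun n => ?_
      refine le_trans ?_ (le_iSup (fun n => v n x) (max n N))
      have : x ∈ spanningSets μ (max n N) := monotone_spanningSets μ (le_max_right _ _) hN
      simp only [v, Set.indicator_of_mem this]
      exact min_le_min_left _ (by exact_mod_cast le_max_left _ _)
    have h6 : u x ≤ ⨆ n, v n x := by
      refine le_trans ?_ h5
      rw [← inf_iSup_eq, ENNReal.iSup_natCast]
      simp
    calc u x ^ q ≤ (⨆ n, v n x) ^ q := ENNReal.rpow_le_rpow h6 hq.le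
      _ = ⨆ n, v n x ^ q := by
        have := (ENNReal.orderIsoRpow q hq).map_iSup (fun n => v n x)
        exact this
  calc (∫⁻ x, u x ^ q ∂μ) ^ (1 / q) ≤ (A ^ q) ^ (1 / q) := by
        refine ENNReal.rpow_le_rpow ?_ (by positivity)
        refine (lintegral_mono hsup).trans ?_
        rw [lintegral_iSup (fun n => (hv n).pow_const q)
          (fun m n hmn x => ENNReal.rpow_le_rpow (hmono hmn x) hq.le)]
        exact iSup_le hbound
    _ = A := by rw [← ENNReal.rpow_mul]; simp [hq.ne']

theorem lintegral_comp_abs {h : ℝ → ℝ≥0∞} :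
    ∫⁻ u : ℝ, h |u| = 2 * ∫⁻ u in Set.Ioi (0 : ℝ), h u := by
  have h1 : ∫⁻ u : ℝ, h |u| =
      (∫⁻ u in Set.Iio (0 : ℝ), h |u|) + ∫⁻ u in Set.Ici (0 : ℝ), h |u| := by
    rw [← lintegral_add_compl _ (measurableSet_Iio (a := (0 : ℝ))), Set.compl_Iio]
  have h2 : ∫⁻ u in Set.Iio (0 : ℝ), h |u| = ∫⁻ u in Set.Ioi (0 : ℝ), h u := by
    have := (Measure.measurePreserving_neg (volume : Measure ℝ)).setLIntegral_comp_preimage_emb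
      (Homeomorph.neg ℝ).measurableEmbedding (fun u => h |u|) (Set.Iio 0)
    rw [← this]
    simp only [abs_neg, Set.neg_preimage, Set.neg_Iio, neg_zero]
    exact setLIntegral_congr_fun measurableSet_Ioi fun u hu => by
      rw [abs_of_pos hu]
  have h3 : ∫⁻ u in Set.Ici (0 : ℝ), h |u| = ∫⁻ u in Set.Ioi (0 : ℝ), h u := by
    rw [setLIntegral_congr (Ioi_ae_eq_Ici (a := (0 : ℝ)) (μ := volume)).symm]
    exact setLIntegral_congr_fun measurableSet_Ioi fun u hu => by
      rw [abs_of_pos hu]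
  rw [h1, h2, h3, two_mul]

theorem lintegral_Ioo_rpow {s R : ℝ} (hs : -1 < s) (hR : 0 ≤ R) :
    ∫⁻ u in Set.Ioo 0 R, ENNReal.ofReal (u ^ s) = ENNReal.ofReal (R ^ (s + 1) / (s + 1)) := by
  rw [← setLIntegral_congr (Ioo_ae_eq_Ioc (a := (0 : ℝ)) (b := R) (μ := volume)).symm,
    ← ofReal_integral_eq_lintegral_ofReal, ← intervalIntegral.integral_of_le hR,
    integral_rpow (Or.inl hs), Real.zero_rpow (by linarith), sub_zero]
  · exact (intervalIntegrable_iff_integrableOn_Ioc_of_le hR).1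
      (intervalIntegral.intervalIntegrable_rpow' hs)
  · exact (ae_restrict_mem measurableSet_Ioc).mono fun u hu => Real.rpow_nonneg hu.1.le _

theorem lintegral_Ici_rpow {s R : ℝ} (hs : s < -1) (hR : 0 < R) :
    ∫⁻ u in Set.Ici R, ENNReal.ofReal (u ^ s) = ENNReal.ofReal (R ^ (s + 1) / (-(s + 1))) := by
  rw [setLIntegral_congr (Ioi_ae_eq_Ici (a := R) (μ := volume)).symm,
    ← ofReal_integral_eq_lintegral_ofReal, integral_Ioi_rpow_of_lt hs hR, div_neg, neg_div]
  · exact integrableOn_Ioi_rpow_of_lt hs hR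
  · exact (ae_restrict_mem measurableSet_Ioi).mono fun u hu => Real.rpow_nonneg (hR.trans hu).le _

theorem enorm_rpow_of_pos {u : ℝ} (hu : 0 < u) (s : ℝ) : ‖u‖ₑ ^ s = ENNReal.ofReal (u ^ s) := by
  rw [← ofReal_norm, Real.norm_of_nonneg hu.le, ENNReal.ofReal_rpow_of_pos hu]

theorem lintegral_enorm_sub_rpow_near {s R : ℝ} (hs : -1 < s) (hR : 0 ≤ R) (x : ℝ) :
    ∫⁻ y, (if |x - y| < R then ‖x - y‖ₑ ^ s else 0) =
      ENNReal.ofReal (2 / (s + 1) * R ^ (s + 1)) := by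
  rw [lintegral_sub_left_eq_self (fun u => if |u| < R then ‖u‖ₑ ^ s else 0) x]
  have := lintegral_comp_abs (h := fun u => if u < R then ‖u‖ₑ ^ s else 0)
  simp only [Real.enorm_abs] at this
  rw [this, ← lintegral_indicator measurableSet_Ioi]
  have h1 : (fun u : ℝ => (Set.Ioi (0 : ℝ)).indicator (fun u => if u < R then ‖u‖ₑ ^ s else 0) u) =
      (Set.Ioo 0 R).indicator fun u => ENNReal.ofReal (u ^ s) := by
    ext u
    by_cases h0 : 0 < u <;> by_cases h1 : u < R <;>
      simp [Set.indicator, h0, h1, enorm_rpow_of_pos]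
  rw [h1, lintegral_indicator measurableSet_Ioo, lintegral_Ioo_rpow hs hR,
    show (2 : ℝ≥0∞) = ENNReal.ofReal 2 by simp, ← ENNReal.ofReal_mul zero_le_two]
  congr 1
  ring

theorem lintegral_enorm_sub_rpow_far {s R : ℝ} (hs : s < -1) (hR : 0 < R) (x : ℝ) :
    ∫⁻ y, (if R ≤ |x - y| then ‖x - y‖ₑ ^ s else 0) =
      ENNReal.ofReal (2 / (-(s + 1)) * R ^ (s + 1)) := by
  rw [lintegral_sub_left_eq_self (fun u => if R ≤ |u| then ‖u‖ₑ ^ s else 0) x]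
  have := lintegral_comp_abs (h := fun u => if R ≤ u then ‖u‖ₑ ^ s else 0)
  simp only [Real.enorm_abs] at this
  rw [this, ← lintegral_indicator measurableSet_Ioi]
  have h1 : (fun u : ℝ => (Set.Ioi (0 : ℝ)).indicator (fun u => if R ≤ u then ‖u‖ₑ ^ s else 0) u) =
      (Set.Ici R).indicator fun u => ENNReal.ofReal (u ^ s) := by
    ext u
    by_cases h1 : R ≤ u
    · simp [Set.indicator, h1, enorm_rpow_of_pos, hR.trans_le h1]
    · simp [Set.indicator, h1]
  rw [h1, lintegral_indicator measurableSet_Ici, lintegral_Ici_rpow hs hR,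
    show (2 : ℝ≥0∞) = ENNReal.ofReal 2 by simp, ← ENNReal.ofReal_mul zero_le_two]
  congr 1
  ring

theorem mul_lintegral_ite_rpow_le {p r l : ℝ} (hp : 1 < p) (hr : 1 < r) (hl : l < 1)
    (hplr : 1 / p + 1 / r + l = 2) :
    ∃ C : ℝ, 0 < C ∧ ∀ G : ℝ → ℝ≥0∞, Measurable G → ∫⁻ y, G y ^ r ≤ 1 → ∀ (a : ℝ≥0∞) (x : ℝ),
      a * ∫⁻ y, (if G y ^ r ≤ a ^ p then ‖x - y‖ₑ ^ (-l) * G y else 0) ≤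
        ENNReal.ofReal C * a ^ p := by
  have hp0 : 0 < p := by linarith
  have hr0 : 0 < r := by linarith
  have hrc := Real.HolderConjugate.conjExponent hr
  set s := Real.conjExponent r with hs
  have hs0 : 0 < s := hrc.symm.pos
  have hs1 : 1 / s = 1 - 1 / r := by rw [one_div, one_div, hrc.one_sub_inv]
  have hp1 : 1 / p < 1 := by rw [div_lt_one hp0]; exact hp
  have hr1 : 1 / r < 1 := by rw [div_lt_one hr0]; exact hr
  have hls : -l * s < -1 := by
    have h : 1 / s < l := by linarith
    rw [div_lt_iff₀ hs0] at h
    linarith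
  set N := 2 / (-l + 1) with hN
  have hN0 : 0 < N := div_pos two_pos (by linarith)
  set M := (2 / (-(-l * s + 1))) with hM
  have hM0 : 0 < M := div_pos two_pos (by linarith)
  refine ⟨N + M ^ (1 / s), by positivity, fun G hG hG1 a x => ?_⟩
  rcases eq_or_ne a 0 with rfl | ha0
  · simp
  rcases eq_or_ne a ∞ with rfl | ha
  · rw [ENNReal.top_rpow_of_pos hp0, ENNReal.mul_top (by simp; positivity)]
    exact le_top
  lift a to NNReal using ha
  obtain ⟨b, hb⟩ : ∃ b : ℝ, b = a := ⟨a, rfl⟩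
  have hb0 : 0 < b := by
    rw [hb]; exact_mod_cast pos_iff_ne_zero.2 (by simpa using ha0)
  have hab : (a : ℝ≥0∞) = ENNReal.ofReal b := by simp [hb]
  rw [hab, ENNReal.ofReal_rpow_of_pos hb0]
  set R := b ^ (-p) with hR
  have hR0 : 0 < R := Real.rpow_pos_of_pos hb0 _
  have hsplit : ∀ y, (if G y ^ r ≤ ENNReal.ofReal (b ^ p) then ‖x - y‖ₑ ^ (-l) * G y else 0) ≤
      (if |x - y| < R then ‖x - y‖ₑ ^ (-l) else 0) * ENNReal.ofReal (b ^ (p / r)) +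
      (if R ≤ |x - y| then ‖x - y‖ₑ ^ (-l) else 0) * G y := by
    intro y
    by_cases h1 : G y ^ r ≤ ENNReal.ofReal (b ^ p)
    · by_cases h2 : |x - y| < R
      · simp only [h1, h2, if_true, not_le.2 h2, if_false, zero_mul, add_zero]
        gcongr
        calc G y = (G y ^ r) ^ (1 / r) := by rw [← ENNReal.rpow_mul]; simp [hr0.ne']
          _ ≤ (ENNReal.ofReal (b ^ p)) ^ (1 / r) := ENNReal.rpow_le_rpow h1 (by positivity)
          _ = _ := by
            rw [ENNReal.ofReal_rpow_of_pos (by positivity), ← Real.rpow_mul hb0.le]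
            ring_nf
      · simp only [h1, h2, if_true, not_lt.1 h2, if_false, zero_mul, zero_add, le_refl]
    · simp [h1]
  have hm : Measurable fun y : ℝ => ‖x - y‖ₑ ^ (-l) := by fun_prop
  have hm1 : Measurable fun y : ℝ => (if |x - y| < R then ‖x - y‖ₑ ^ (-l) else 0) :=
    Measurable.ite (measurableSet_lt (by fun_prop) measurable_const) hm measurable_const
  have hm2 : Measurable fun y : ℝ => (if R ≤ |x - y| then ‖x - y‖ₑ ^ (-l) else 0) :=
    Measurable.ite (measurableSet_le measurable_const (by fun_prop)) hm measurable_const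
  have hfar : ∫⁻ y, (if R ≤ |x - y| then ‖x - y‖ₑ ^ (-l) else 0) * G y ≤
      ENNReal.ofReal (M ^ (1 / s) * R ^ (-l + 1 / s)) := by
    refine (ENNReal.lintegral_mul_le_Lp_mul_Lq volume hrc.symm hm2.aemeasurable
      hG.aemeasurable).trans ?_
    have h1 : ∀ y, (if R ≤ |x - y| then ‖x - y‖ₑ ^ (-l) else 0) ^ s =
        if R ≤ |x - y| then ‖x - y‖ₑ ^ (-l * s) else 0 := by
      intro y
      split_ifs
      · rw [ENNReal.rpow_mul]
      · exact ENNReal.zero_rpow_of_pos hs0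
    simp only [h1]
    rw [lintegral_enorm_sub_rpow_far hls hR0, ENNReal.ofReal_rpow_of_pos (by positivity),
      Real.mul_rpow (by positivity) (by positivity), ← Real.rpow_mul hR0.le]
    calc _ ≤ ENNReal.ofReal (M ^ (1 / s) * R ^ ((-l * s + 1) * (1 / s))) * 1 := by
          gcongr
          exact ENNReal.rpow_le_one hG1 (by positivity)
      _ = _ := by
        rw [mul_one]
        congr 3
        field_simp
  calc _ ≤ ENNReal.ofReal b * (ENNReal.ofReal (N * R ^ (-l + 1)) * ENNReal.ofReal (b ^ (p / r)) +
        ENNReal.ofReal (M ^ (1 / s) * R ^ (-l + 1 / s))) := by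
        gcongr
        refine (lintegral_mono hsplit).trans ?_
        rw [lintegral_add_left (hm1.mul_const _), lintegral_mul_const _ hm1,
          lintegral_enorm_sub_rpow_near (by linarith) hR0.le]
        gcongr
    _ = ENNReal.ofReal ((N + M ^ (1 / s)) * b ^ p) := by
        rw [← ENNReal.ofReal_mul (by positivity), ← ENNReal.ofReal_add (by positivity)
          (by positivity), ← ENNReal.ofReal_mul hb0.le]
        congr 1
        have e1 : b * (R ^ (-l + 1) * b ^ (p / r)) = b ^ p := by
          rw [hR, ← Real.rpow_mul hb0.le, ← Real.rpow_add hb0]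
          nth_rw 1 [← Real.rpow_one b]
          rw [← Real.rpow_add hb0]
          congr 1
          have : l = 2 - 1 / p - 1 / r := by linarith
          rw [this]
          field_simp
          ring
        have e2 : b * R ^ (-l + 1 / s) = b ^ p := by
          rw [hR, ← Real.rpow_mul hb0.le]
          nth_rw 1 [← Real.rpow_one b]
          rw [← Real.rpow_add hb0]
          congr 1
          have : -l + 1 / s = 1 / p - 1 := by rw [hs1]; linarith
          rw [this]
          field_simp
          ring
        linear_combination N * e1 + M ^ (1 / s) * e2
    _ = _ := ENNReal.ofReal_mul (by positivity)

theorem lintegral_lintegral_enorm_rpow_le_of_le_one {p r l : ℝ} (hp : 1 < p) (hr : 1 < r)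
    (hl : l < 1) (hplr : 1 / p + 1 / r + l = 2) :
    ∃ C : ℝ, 0 < C ∧ ∀ F G : ℝ → ℝ≥0∞, Measurable F → Measurable G → ∫⁻ x, F x ^ p ≤ 1 →
      ∫⁻ y, G y ^ r ≤ 1 →
      ∫⁻ x, ∫⁻ y, F x * (‖x - y‖ₑ ^ (-l) * G y) ≤ ENNReal.ofReal C := by
  obtain ⟨C₁, hC₁, h₁⟩ := mul_lintegral_ite_rpow_le hp hr hl hplr
  obtain ⟨C₂, hC₂, h₂⟩ := mul_lintegral_ite_rpow_le hr hp hl (by linarith)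
  refine ⟨C₁ + C₂, by positivity, fun F G hF hG hF1 hG1 => ?_⟩
  have hk : Measurable fun z : ℝ × ℝ => ‖z.1 - z.2‖ₑ ^ (-l) := by fun_prop
  have hm1 : Measurable fun z : ℝ × ℝ =>
      F z.1 * (if G z.2 ^ r ≤ F z.1 ^ p then ‖z.1 - z.2‖ₑ ^ (-l) * G z.2 else 0) := by
    refine (hF.comp measurable_fst).mul (Measurable.ite ?_ ?_ measurable_const)
    · exact measurableSet_le ((hG.comp measurable_snd).pow_const r)
        ((hF.comp measurable_fst).pow_const p)
    · exact hk.mul (hG.comp measurable_snd)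
  have hm2 : Measurable fun z : ℝ × ℝ =>
      G z.2 * (if F z.1 ^ p ≤ G z.2 ^ r then ‖z.2 - z.1‖ₑ ^ (-l) * F z.1 else 0) := by
    refine (hG.comp measurable_snd).mul (Measurable.ite ?_ ?_ measurable_const)
    · exact measurableSet_le ((hF.comp measurable_fst).pow_const p)
        ((hG.comp measurable_snd).pow_const r)
    · exact (hk.comp measurable_swap).mul (hF.comp measurable_fst)
  calc _ ≤ ∫⁻ x, ∫⁻ y, (F x * (if G y ^ r ≤ F x ^ p then ‖x - y‖ₑ ^ (-l) * G y else 0) +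
        G y * (if F x ^ p ≤ G y ^ r then ‖y - x‖ₑ ^ (-l) * F x else 0)) := by
        refine lintegral_mono fun x => lintegral_mono fun y => ?_
        rcases le_total (G y ^ r) (F x ^ p) with h | h
        · simp only [h, if_true]
          exact le_self_add
        · simp only [h, if_true]
          refine le_trans (le_of_eq ?_) le_add_self
          rw [enorm_sub_rev]
          ring
    _ = (∫⁻ x, ∫⁻ y, F x * (if G y ^ r ≤ F x ^ p then ‖x - y‖ₑ ^ (-l) * G y else 0)) +
        ∫⁻ y, ∫⁻ x, G y * (if F x ^ p ≤ G y ^ r then ‖y - x‖ₑ ^ (-l) * F x else 0) := by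
        rw [lintegral_lintegral_swap (f := fun y x => G y *
          (if F x ^ p ≤ G y ^ r then ‖y - x‖ₑ ^ (-l) * F x else 0))
          (hm2.comp measurable_swap).aemeasurable, ← lintegral_add_left hm1.lintegral_prod_right']
        exact lintegral_congr fun x => lintegral_add_left (hm1.comp measurable_prodMk_left) _
    _ ≤ (∫⁻ x, ENNReal.ofReal C₁ * F x ^ p) + ∫⁻ y, ENNReal.ofReal C₂ * G y ^ r := by
        gcongr with x y
        · rw [lintegral_const_mul _ (Measurable.ite (measurableSet_le (hG.pow_const r)
            measurable_const) (by fun_prop) measurable_const)]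
          exact h₁ G hG hG1 (F x) x
        · rw [lintegral_const_mul _ (Measurable.ite (measurableSet_le (hF.pow_const p)
            measurable_const) (by fun_prop) measurable_const)]
          exact h₂ F hF hF1 (G y) y
    _ ≤ ENNReal.ofReal C₁ * 1 + ENNReal.ofReal C₂ * 1 := by
        rw [lintegral_const_mul _ (hF.pow_const p), lintegral_const_mul _ (hG.pow_const r)]
        gcongr
    _ = _ := by rw [mul_one, mul_one, ENNReal.ofReal_add hC₁.le hC₂.le]

theorem lintegral_lintegral_enorm_rpow_le {p r l : ℝ} (hp : 1 < p) (hr : 1 < r)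
    (hl : l < 1) (hplr : 1 / p + 1 / r + l = 2) :
    ∃ C : ℝ, 0 < C ∧ ∀ F G : ℝ → ℝ≥0∞, Measurable F → Measurable G →
      ∫⁻ x, ∫⁻ y, F x * (‖x - y‖ₑ ^ (-l) * G y) ≤
        ENNReal.ofReal C * ((∫⁻ x, F x ^ p) ^ (1 / p) * (∫⁻ y, G y ^ r) ^ (1 / r)) := by
  obtain ⟨C, hC, h⟩ := lintegral_lintegral_enorm_rpow_le_of_le_one hp hr hl hplr
  have hp0 : 0 < p := by linarith
  have hr0 : 0 < r := by linarith
  refine ⟨C, hC, fun F G hF hG => ?_⟩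
  set A := (∫⁻ x, F x ^ p) ^ (1 / p) with hA
  set B := (∫⁻ y, G y ^ r) ^ (1 / r) with hB
  have hC' : ENNReal.ofReal C ≠ 0 := by simpa using hC
  by_cases hA0 : A = 0
  · have : ∀ᵐ x, F x = 0 := by
      have h1 : ∫⁻ x, F x ^ p = 0 := by
        rw [hA, ENNReal.rpow_eq_zero_iff_of_pos (by positivity)] at hA0; exact hA0
      rw [lintegral_eq_zero_iff (hF.pow_const p)] at h1
      filter_upwards [h1] with x hx
      exact (ENNReal.rpow_eq_zero_iff_of_pos hp0).1 hx
    rw [lintegral_congr_ae (g := 0) (by filter_upwards [this] with x hx; simp [hx])]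
    simp
  by_cases hB0 : B = 0
  · have : ∀ᵐ y, G y = 0 := by
      have h1 : ∫⁻ x, G x ^ r = 0 := by
        rw [hB, ENNReal.rpow_eq_zero_iff_of_pos (by positivity)] at hB0; exact hB0
      rw [lintegral_eq_zero_iff (hG.pow_const r)] at h1
      filter_upwards [h1] with x hx
      exact (ENNReal.rpow_eq_zero_iff_of_pos hr0).1 hx
    have h2 : ∀ x, ∫⁻ y, F x * (‖x - y‖ₑ ^ (-l) * G y) = 0 := fun x => by
      rw [lintegral_congr_ae (g := 0) (by filter_upwards [this] with x hx; simp [hx])]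
      simp
    simp [h2]
  by_cases hAt : A = ∞
  · rw [hAt, ENNReal.top_mul hB0, ENNReal.mul_top hC']; exact le_top
  by_cases hBt : B = ∞
  · rw [hBt, ENNReal.mul_top hA0, ENNReal.mul_top hC']; exact le_top
  have key : ∀ {f : ℝ → ℝ≥0∞} {t : ℝ} (ht : 0 < t), Measurable f →
      (∫⁻ x, f x ^ t) ^ (1 / t) ≠ 0 → (∫⁻ x, f x ^ t) ^ (1 / t) ≠ ∞ →
      ∫⁻ x, (((∫⁻ x, f x ^ t) ^ (1 / t))⁻¹ * f x) ^ t ≤ 1 := by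
    intro f t ht hf h0 h1
    simp_rw [ENNReal.mul_rpow_of_nonneg _ _ ht.le]
    rw [lintegral_const_mul _ (hf.pow_const t), ENNReal.inv_rpow, ← ENNReal.rpow_mul,
      one_div_mul_cancel ht.ne', ENNReal.rpow_one]
    exact ENNReal.inv_mul_le_one _
  have h1 := h (fun x => A⁻¹ * F x) (fun y => B⁻¹ * G y) (hF.const_mul _) (hG.const_mul _)
    (key hp0 hF hA0 hAt) (key hr0 hG hB0 hBt)
  have h2 : ∫⁻ x, ∫⁻ y, F x * (‖x - y‖ₑ ^ (-l) * G y) =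
      A * B * ∫⁻ x, ∫⁻ y, (A⁻¹ * F x) * (‖x - y‖ₑ ^ (-l) * (B⁻¹ * G y)) := by
    have hAB : A * B ≠ ∞ := ENNReal.mul_ne_top hAt hBt
    rw [← lintegral_const_mul' _ _ hAB]
    refine lintegral_congr fun x => ?_
    rw [← lintegral_const_mul' _ _ hAB]
    refine lintegral_congr fun y => ?_
    calc _ = (A * A⁻¹) * (B * B⁻¹) * (F x * (‖x - y‖ₑ ^ (-l) * G y)) := by
          rw [ENNReal.mul_inv_cancel hA0 hAt, ENNReal.mul_inv_cancel hB0 hBt]; simp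
      _ = _ := by ring
  rw [h2, mul_comm (ENNReal.ofReal C)]
  gcongr

theorem lintegral_fin_succ (n : ℕ) (F : (Fin (n + 1) → ℝ) → ℝ≥0∞) (hF : Measurable F) :
    ∫⁻ x, F x = ∫⁻ x₀ : ℝ, ∫⁻ x' : Fin n → ℝ, F (Fin.cons x₀ x') := by
  have h := (volume_preserving_piFinSuccAbove (fun _ : Fin (n + 1) => ℝ) 0).symm
  rw [← h.lintegral_comp hF, Measure.volume_eq_prod, lintegral_prod]
  · refine lintegral_congr fun x => lintegral_congr fun y => ?_
    simp [MeasurableEquiv.piFinSuccAbove, Fin.insertNthEquiv]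
  · exact (hF.comp (MeasurableEquiv.measurable _)).aemeasurable

theorem measurable_fin_cons (n : ℕ) :
    Measurable fun z : ℝ × (Fin n → ℝ) => (Fin.cons z.1 z.2 : Fin (n + 1) → ℝ) := by
  refine measurable_pi_lambda _ fun i => ?_
  refine Fin.cases ?_ (fun j => ?_) i
  · simpa using measurable_fst
  · simpa using (by fun_prop : Measurable fun c : ℝ × (Fin n → ℝ) => c.2 j)

theorem lintegral_lintegral_prod_enorm_rpow_le {p r l : ℝ} (hp : 1 < p) (hr : 1 < r)
    (hl : l < 1) (hplr : 1 / p + 1 / r + l = 2) (n : ℕ) :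
    ∃ C : ℝ, 0 < C ∧ ∀ F G : (Fin n → ℝ) → ℝ≥0∞, Measurable F → Measurable G →
      ∫⁻ x, ∫⁻ y, F x * ((∏ i, ‖x i - y i‖ₑ ^ (-l)) * G y) ≤
        ENNReal.ofReal C * ((∫⁻ x, F x ^ p) ^ (1 / p) * (∫⁻ y, G y ^ r) ^ (1 / r)) := by
  have hp0 : 0 < p := by linarith
  have hr0 : 0 < r := by linarith
  obtain ⟨C₁, hC₁, h₁⟩ := lintegral_lintegral_enorm_rpow_le hp hr hl hplr
  induction n with
  | zero =>
    refine ⟨1, one_pos, fun F G hF hG => ?_⟩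
    simp only [Finset.univ_eq_empty, Finset.prod_empty, one_mul, ENNReal.ofReal_one]
    simp only [lintegral_unique, volume_pi, Measure.pi_empty_univ, mul_one, ← ENNReal.rpow_mul]
    rw [mul_one_div_cancel hp0.ne', mul_one_div_cancel hr0.ne', ENNReal.rpow_one, ENNReal.rpow_one]
  | succ n ih =>
    obtain ⟨C₂, hC₂, h₂⟩ := ih
    refine ⟨C₁ * C₂, by positivity, fun F G hF hG => ?_⟩
    have hFc : Measurable fun z : ℝ × (Fin n → ℝ) => F (Fin.cons z.1 z.2) :=
      hF.comp (measurable_fin_cons n)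
    have hGc : Measurable fun z : ℝ × (Fin n → ℝ) => G (Fin.cons z.1 z.2) :=
      hG.comp (measurable_fin_cons n)
    have hFc' : ∀ x₀ : ℝ, Measurable fun x' : Fin n → ℝ => F (Fin.cons x₀ x') := fun x₀ =>
      hFc.comp measurable_prodMk_left
    have hGc' : ∀ x₀ : ℝ, Measurable fun x' : Fin n → ℝ => G (Fin.cons x₀ x') := fun x₀ =>
      hGc.comp measurable_prodMk_left
    set f : ℝ → ℝ≥0∞ := fun x₀ => (∫⁻ x' : Fin n → ℝ, F (Fin.cons x₀ x') ^ p) ^ (1 / p) with hf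
    set g : ℝ → ℝ≥0∞ := fun x₀ => (∫⁻ x' : Fin n → ℝ, G (Fin.cons x₀ x') ^ r) ^ (1 / r) with hg
    have hfm : Measurable f := ((hFc.pow_const p).lintegral_prod_right').pow_const _
    have hgm : Measurable g := ((hGc.pow_const r).lintegral_prod_right').pow_const _
    have hker : Measurable fun z : (Fin (n + 1) → ℝ) × (Fin (n + 1) → ℝ) =>
        F z.1 * ((∏ i, ‖z.1 i - z.2 i‖ₑ ^ (-l)) * G z.2) := by fun_prop
    have hker' : Measurable fun z : (ℝ × (Fin n → ℝ)) × (ℝ × (Fin n → ℝ)) =>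
        F (Fin.cons z.1.1 z.1.2) * ((‖z.1.1 - z.2.1‖ₑ ^ (-l) *
          ∏ i, ‖z.1.2 i - z.2.2 i‖ₑ ^ (-l)) * G (Fin.cons z.2.1 z.2.2)) := by fun_prop
    calc _ = ∫⁻ x₀ : ℝ, ∫⁻ x' : Fin n → ℝ, ∫⁻ y₀ : ℝ, ∫⁻ y' : Fin n → ℝ,
          F (Fin.cons x₀ x') * ((‖x₀ - y₀‖ₑ ^ (-l) *
            ∏ i, ‖x' i - y' i‖ₑ ^ (-l)) * G (Fin.cons y₀ y')) := by
          rw [lintegral_fin_succ n _ hker.lintegral_prod_right']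
          refine lintegral_congr fun x₀ => lintegral_congr fun x' => ?_
          rw [lintegral_fin_succ n (fun y => F (Fin.cons x₀ x') *
            ((∏ i, ‖(Fin.cons x₀ x' : Fin (n + 1) → ℝ) i - y i‖ₑ ^ (-l)) * G y))
            (hker.comp measurable_prodMk_left)]
          refine lintegral_congr fun y₀ => lintegral_congr fun y' => ?_
          simp [Fin.prod_univ_succ]
      _ = ∫⁻ x₀ : ℝ, ∫⁻ y₀ : ℝ, ∫⁻ x' : Fin n → ℝ, ∫⁻ y' : Fin n → ℝ,
          F (Fin.cons x₀ x') * ((‖x₀ - y₀‖ₑ ^ (-l) *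
            ∏ i, ‖x' i - y' i‖ₑ ^ (-l)) * G (Fin.cons y₀ y')) := by
          refine lintegral_congr fun x₀ => lintegral_lintegral_swap ?_
          have : Measurable fun z : ((Fin n → ℝ) × ℝ) × (Fin n → ℝ) =>
            F (Fin.cons x₀ z.1.1) * ((‖x₀ - z.1.2‖ₑ ^ (-l) *
              ∏ i, ‖z.1.1 i - z.2 i‖ₑ ^ (-l)) * G (Fin.cons z.1.2 z.2)) :=
            hker'.comp (f := fun z : ((Fin n → ℝ) × ℝ) × (Fin n → ℝ) =>
              ((x₀, z.1.1), (z.1.2, z.2))) (by fun_prop)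
          exact this.lintegral_prod_right'.aemeasurable
      _ = ∫⁻ x₀ : ℝ, ∫⁻ y₀ : ℝ, ‖x₀ - y₀‖ₑ ^ (-l) * ∫⁻ x' : Fin n → ℝ, ∫⁻ y' : Fin n → ℝ,
          F (Fin.cons x₀ x') * ((∏ i, ‖x' i - y' i‖ₑ ^ (-l)) * G (Fin.cons y₀ y')) := by
          refine lintegral_congr fun x₀ => lintegral_congr fun y₀ => ?_
          have h3 : Measurable fun z : (Fin n → ℝ) × (Fin n → ℝ) =>
              F (Fin.cons x₀ z.1) * ((∏ i, ‖z.1 i - z.2 i‖ₑ ^ (-l)) * G (Fin.cons y₀ z.2)) := by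
            have := hFc' x₀
            have := hGc' y₀
            fun_prop
          rw [← lintegral_const_mul _ h3.lintegral_prod_right']
          refine lintegral_congr fun x' => ?_
          have h4 : Measurable fun y' : Fin n → ℝ =>
              F (Fin.cons x₀ x') * ((∏ i, ‖x' i - y' i‖ₑ ^ (-l)) * G (Fin.cons y₀ y')) :=
            h3.comp measurable_prodMk_left
          rw [← lintegral_const_mul _ h4]
          exact lintegral_congr fun y' => by ring
      _ ≤ ∫⁻ x₀ : ℝ, ∫⁻ y₀ : ℝ, ‖x₀ - y₀‖ₑ ^ (-l) * (ENNReal.ofReal C₂ * (f x₀ * g y₀)) := by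
          gcongr with x₀ y₀
          exact h₂ _ _ (hFc' x₀) (hGc' y₀)
      _ = ENNReal.ofReal C₂ * ∫⁻ x₀ : ℝ, ∫⁻ y₀ : ℝ, f x₀ * (‖x₀ - y₀‖ₑ ^ (-l) * g y₀) := by
          rw [← lintegral_const_mul' _ _ ENNReal.ofReal_ne_top]
          refine lintegral_congr fun x₀ => ?_
          rw [← lintegral_const_mul' _ _ ENNReal.ofReal_ne_top]
          exact lintegral_congr fun y₀ => by ring
      _ ≤ ENNReal.ofReal C₂ * (ENNReal.ofReal C₁ *
          ((∫⁻ x, f x ^ p) ^ (1 / p) * (∫⁻ y, g y ^ r) ^ (1 / r))) := by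
          gcongr
          exact h₁ f g hfm hgm
      _ = _ := by
          rw [ENNReal.ofReal_mul hC₁.le, lintegral_fin_succ n _ (hF.pow_const p),
            lintegral_fin_succ n _ (hG.pow_const r)]
          simp only [hf, hg, ← ENNReal.rpow_mul]
          rw [one_div_mul_cancel hp0.ne', one_div_mul_cancel hr0.ne']
          simp only [ENNReal.rpow_one]
          ring

/-- The product Riesz kernel `∏ᵢ |xᵢ|^(s - 1)`. -/
noncomputable def prodRiesz {d : ℕ} (s : ℝ) (x : EuclideanSpace ℝ (Fin d)) : ℝ≥0∞ :=
  ∏ i, ‖x i‖ₑ ^ (s - 1)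

/-- Convolution of `ℝ≥0∞`-valued functions. -/
noncomputable def posConv {d : ℕ} (k F : EuclideanSpace ℝ (Fin d) → ℝ≥0∞)
    (x : EuclideanSpace ℝ (Fin d)) : ℝ≥0∞ :=
  ∫⁻ y, k (x - y) * F y

theorem measurable_prodRiesz {d : ℕ} (s : ℝ) :
    Measurable (prodRiesz s : EuclideanSpace ℝ (Fin d) → ℝ≥0∞) := by
  unfold prodRiesz
  fun_prop

theorem measurable_posConv {d : ℕ} {k F : EuclideanSpace ℝ (Fin d) → ℝ≥0∞}
    (hk : Measurable k) (hF : Measurable F) : Measurable (posConv k F) := by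
  have : Measurable fun z : EuclideanSpace ℝ (Fin d) × EuclideanSpace ℝ (Fin d) =>
    k (z.1 - z.2) * F z.2 := by fun_prop
  exact this.lintegral_prod_right'

theorem lintegral_euclidean {d : ℕ} (F : EuclideanSpace ℝ (Fin d) → ℝ≥0∞) :
    ∫⁻ x, F x = ∫⁻ x : Fin d → ℝ, F (WithLp.toLp 2 x) :=
  ((PiLp.volume_preserving_toLp (Fin d)).lintegral_comp_emb
    (MeasurableEquiv.toLp 2 (Fin d → ℝ)).measurableEmbedding F).symm

/-- The Hardy–Littlewood–Sobolev inequality for product Riesz kernels. -/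
theorem lintegral_posConv_prodRiesz_le {p q s : ℝ} (d : ℕ) (hp : 1 < p) (hq : 0 < q) (hs : 0 < s)
    (hpq : 1 / q = 1 / p - s) :
    ∃ C : ℝ, 0 < C ∧ ∀ F : EuclideanSpace ℝ (Fin d) → ℝ≥0∞, Measurable F →
      (∫⁻ x, posConv (prodRiesz s) F x ^ q) ^ (1 / q) ≤
        ENNReal.ofReal C * (∫⁻ x, F x ^ p) ^ (1 / p) := by
  have hp0 : 0 < p := by linarith
  have hp1 : 1 / p < 1 := by rw [div_lt_one hp0]; exact hp
  have hq1 : 1 < q := by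
    have : 1 / q < 1 := by linarith
    rwa [div_lt_one hq] at this
  have hqc := Real.HolderConjugate.conjExponent hq1
  set r := Real.conjExponent q with hr
  have hr1 : 1 / r = 1 - 1 / q := by rw [one_div, one_div, hqc.one_sub_inv]
  obtain ⟨C, hC, h⟩ := lintegral_lintegral_prod_enorm_rpow_le (l := 1 - s) hqc.symm.lt hp
    (by linarith) (by linarith) d
  refine ⟨C, hC, fun F hF => ?_⟩
  refine lintegral_rpow_rpow_inv_le_of_forall_lintegral_mul_le hqc
    (measurable_posConv (measurable_prodRiesz s) hF) fun G hG => ?_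
  have h1 := h (fun x => G (WithLp.toLp 2 x)) (fun x => F (WithLp.toLp 2 x))
    (hG.comp (MeasurableEquiv.toLp 2 (Fin d → ℝ)).measurable)
    (hF.comp (MeasurableEquiv.toLp 2 (Fin d → ℝ)).measurable)
  rw [lintegral_euclidean, lintegral_euclidean (fun x => G x ^ r),
    lintegral_euclidean (fun x => F x ^ p), mul_assoc, mul_comm (_ ^ (1 / p))]
  refine le_trans (le_of_eq ?_) h1
  refine lintegral_congr fun x => ?_
  have hk : Measurable fun y : Fin d → ℝ => (∏ i, ‖x i - y i‖ₑ ^ (-(1 - s))) *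
      F (WithLp.toLp 2 y) :=
    Measurable.mul (by fun_prop) (hF.comp (MeasurableEquiv.toLp 2 (Fin d → ℝ)).measurable)
  rw [lintegral_const_mul _ hk, mul_comm, posConv, lintegral_euclidean]
  simp [prodRiesz]

/-- The kernel `∏ᵢ (r + |xᵢ|)⁻¹`. -/
noncomputable def prodCauchy {d : ℕ} (r : ℝ) (x : EuclideanSpace ℝ (Fin d)) : ℝ≥0∞ :=
  ∏ i, (ENNReal.ofReal r + ‖x i‖ₑ)⁻¹

theorem rpow_mul_inv_add_le {δ r : ℝ} (hδ : 0 < δ) (hδ1 : δ < 1) (hr : 0 < r) (y : ℝ) :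
    ENNReal.ofReal (r ^ δ) * (ENNReal.ofReal r + ‖y‖ₑ)⁻¹ ≤ ‖y‖ₑ ^ (δ - 1) := by
  rcases eq_or_ne y 0 with rfl | hy
  · simp [ENNReal.zero_rpow_of_neg (show δ - 1 < 0 by linarith)]
  have hy' : 0 < |y| := abs_pos.2 hy
  rw [← Real.enorm_abs y, enorm_rpow_of_pos hy', Real.enorm_of_nonneg hy'.le,
    ← ENNReal.ofReal_add hr.le hy'.le, ← ENNReal.ofReal_inv_of_pos (by positivity),
    ← ENNReal.ofReal_mul (by positivity)]
  apply ENNReal.ofReal_le_ofReal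
  rw [← div_eq_mul_inv, div_le_iff₀ (by positivity)]
  have h1 : r ^ δ ≤ (r + |y|) ^ δ := by gcongr; linarith
  have h2 : (r + |y|) ^ (δ - 1) ≤ |y| ^ (δ - 1) :=
    Real.rpow_le_rpow_of_nonpos hy' (by linarith) (by linarith)
  calc r ^ δ ≤ (r + |y|) ^ (δ - 1) * (r + |y|) := by
        rwa [Real.rpow_sub_one (by positivity), div_mul_cancel₀ _ (by positivity)]
    _ ≤ _ := by gcongr

theorem lintegral_rpow_mul_inv_add_le {δ : ℝ} (hδ : 0 < δ) (hδ1 : δ < 1) :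
    ∃ C : ℝ, 0 < C ∧ ∀ y : ℝ,
      ∫⁻ r in Set.Ioi (0 : ℝ), ENNReal.ofReal (r ^ (δ - 1)) * (ENNReal.ofReal r + ‖y‖ₑ)⁻¹ ≤
        ENNReal.ofReal C * ‖y‖ₑ ^ (δ - 1) := by
  have hδ2 : 0 < 1 - δ := by linarith
  refine ⟨1 / δ + 1 / (1 - δ), by positivity, fun y => ?_⟩
  rcases eq_or_ne y 0 with rfl | hy
  · have : 0 < 1 / δ + 1 / (1 - δ) := by positivity
    rw [enorm_zero, ENNReal.zero_rpow_of_neg (show δ - 1 < 0 by linarith),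
      ENNReal.mul_top (by simpa using this)]
    exact le_top
  have hy' : 0 < |y| := abs_pos.2 hy
  rw [← Real.enorm_abs y, enorm_rpow_of_pos hy', Real.enorm_of_nonneg hy'.le]
  set u := |y|
  rw [← Set.Ioo_union_Ici_eq_Ioi hy']
  refine (lintegral_union_le _ _ _).trans ?_
  have h1 : ∫⁻ r in Set.Ioo 0 u, ENNReal.ofReal (r ^ (δ - 1)) *
      (ENNReal.ofReal r + ENNReal.ofReal u)⁻¹ ≤ ENNReal.ofReal (1 / δ * u ^ (δ - 1)) := by
    calc _ ≤ ∫⁻ r in Set.Ioo 0 u, ENNReal.ofReal (r ^ (δ - 1)) * (ENNReal.ofReal u)⁻¹ := by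
          gcongr
          exact le_add_self
      _ = _ := by
          rw [lintegral_mul_const' _ _ (by simpa using hy'),
            lintegral_Ioo_rpow (by linarith) hy'.le, ← ENNReal.ofReal_inv_of_pos hy',
            sub_add_cancel, ← ENNReal.ofReal_mul (by positivity)]
          congr 1
          rw [Real.rpow_sub_one hy'.ne']
          ring
  have h2 : ∫⁻ r in Set.Ici u, ENNReal.ofReal (r ^ (δ - 1)) *
      (ENNReal.ofReal r + ENNReal.ofReal u)⁻¹ ≤ ENNReal.ofReal (1 / (1 - δ) * u ^ (δ - 1)) := by
    calc _ ≤ ∫⁻ r in Set.Ici u, ENNReal.ofReal (r ^ (δ - 2)) := by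
          refine setLIntegral_mono' measurableSet_Ici fun r hr => ?_
          have hr0 : 0 < r := hy'.trans_le hr
          calc _ ≤ ENNReal.ofReal (r ^ (δ - 1)) * (ENNReal.ofReal r)⁻¹ := by
                gcongr
                exact le_self_add
            _ = _ := by
                rw [← ENNReal.ofReal_inv_of_pos hr0, ← ENNReal.ofReal_mul (by positivity),
                  show δ - 2 = δ - 1 - 1 by ring, Real.rpow_sub_one hr0.ne' (δ - 1)]
                rfl
      _ = _ := by
          rw [lintegral_Ici_rpow (by linarith) hy']
          congr 1
          rw [show δ - 2 + 1 = δ - 1 by ring, neg_sub]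
          ring
  refine (add_le_add h1 h2).trans (le_of_eq ?_)
  rw [← ENNReal.ofReal_add (by positivity) (by positivity), ← ENNReal.ofReal_mul (by positivity)]
  congr 1
  ring

theorem lintegral_rpow_mul_prodCauchy_le {δ : ℝ} (hδ : 0 < δ) (hδ1 : δ < 1) {d : ℕ} (hd : 1 ≤ d) :
    ∃ C : ℝ, 0 < C ∧ ∀ x : EuclideanSpace ℝ (Fin d),
      ∫⁻ r in Set.Ioi (0 : ℝ), ENNReal.ofReal (r ^ (d * δ - 1)) * prodCauchy r x ≤
        ENNReal.ofReal C * prodRiesz δ x := by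
  obtain ⟨C, hC, h⟩ := lintegral_rpow_mul_inv_add_le hδ hδ1
  refine ⟨C, hC, fun x => ?_⟩
  obtain ⟨n, rfl⟩ : ∃ n, d = n + 1 := ⟨d - 1, by omega⟩
  calc _ ≤ ∫⁻ r in Set.Ioi (0 : ℝ), (ENNReal.ofReal (r ^ (δ - 1)) *
        (ENNReal.ofReal r + ‖x 0‖ₑ)⁻¹) * ∏ i : Fin n, ‖x i.succ‖ₑ ^ (δ - 1) := by
        refine setLIntegral_mono' measurableSet_Ioi fun r (hr : 0 < r) => ?_
        rw [prodCauchy, Fin.prod_univ_succ]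
        have h1 : r ^ ((n + 1 : ℕ) * δ - 1) = r ^ (δ - 1) * ∏ i : Fin n, r ^ δ := by
          rw [Finset.prod_const, Finset.card_univ, Fintype.card_fin, ← Real.rpow_natCast,
            ← Real.rpow_mul hr.le, ← Real.rpow_add hr]
          congr 1
          push_cast
          ring
        rw [h1, ENNReal.ofReal_mul (by positivity),
          ENNReal.ofReal_prod_of_nonneg (fun i _ => by positivity), mul_mul_mul_comm,
          ← Finset.prod_mul_distrib]
        gcongr with i _
        exact rpow_mul_inv_add_le hδ hδ1 hr _
    _ = (∫⁻ r in Set.Ioi (0 : ℝ), (ENNReal.ofReal (r ^ (δ - 1)) *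
        (ENNReal.ofReal r + ‖x 0‖ₑ)⁻¹)) * ∏ i : Fin n, ‖x i.succ‖ₑ ^ (δ - 1) :=
        lintegral_mul_const _ (by fun_prop)
    _ ≤ _ := by
        rw [prodRiesz, Fin.prod_univ_succ, ← mul_assoc]
        gcongr
        exact h _

section GaussRegularization

variable {V : Type*} [NormedAddCommGroup V] [InnerProductSpace ℝ V] [MeasurableSpace V]
  [BorelSpace V] [FiniteDimensional ℝ V]

open Real Complex Filter Topology in
theorem integral_gaussian_mul_fourier_eq {Ψ : V → ℂ} (hΨ : Integrable Ψ) {c : ℝ} (hc : 0 < c)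
    (v : V) :
    ∫ w : V, cexp (-c⁻¹ * ‖w‖ ^ 2 + 2 * π * I * ⟪v, w⟫) * 𝓕 Ψ w =
      ∫ w : V, ((π * c : ℂ) ^ (Module.finrank ℝ V / 2 : ℂ) *
        cexp (-π ^ 2 * c * ‖v - w‖ ^ 2)) • Ψ w := by
  have J : Integrable (fun w ↦ cexp (- c⁻¹ * ‖w‖ ^ 2 + 2 * π * I * ⟪v, w⟫)) :=
    GaussianFourier.integrable_cexp_neg_mul_sq_norm_add (by simpa) _ _
  have := (VectorFourier.integral_fourierIntegral_smul_eq_flip (L := innerₗ V)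
    Real.continuous_fourierChar continuous_inner J hΨ).symm
  calc _ = ∫ w : V, 𝓕 (fun w ↦ cexp (- c⁻¹ * ‖w‖ ^ 2 + 2 * π * I * ⟪v, w⟫)) w • Ψ w := by
        simpa using! this
    _ = _ := by
        congr with w
        rw [fourier_gaussian_innerProductSpace' (by simpa)]
        congr
        · simp
        · simp; ring

open Real Complex Filter Topology in
theorem norm_integral_gaussian_smul_le {Ψ : V → ℂ} {M : ℝ} (hM : ∀ w, ‖Ψ w‖ ≤ M) {c : ℝ}
    (hc : 0 < c) (v : V) :
    ‖∫ w : V, ((π * c : ℂ) ^ (Module.finrank ℝ V / 2 : ℂ) *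
        cexp (-π ^ 2 * c * ‖v - w‖ ^ 2)) • Ψ w‖ ≤ M := by
  have hM0 : 0 ≤ M := (norm_nonneg _).trans (hM 0)
  have hnorm : ∀ w : V, ‖((π * c : ℂ) ^ (Module.finrank ℝ V / 2 : ℂ) *
      cexp (-π ^ 2 * c * ‖v - w‖ ^ 2))‖ =
      (π * c) ^ (Module.finrank ℝ V / 2 : ℝ) * Real.exp (-(π ^ 2 * c) * ‖v - w‖ ^ 2) := by
    intro w
    rw [norm_mul, Complex.norm_exp]
    congr 1
    · rw [← Complex.ofReal_mul, Complex.norm_cpow_eq_rpow_re_of_pos (by positivity)]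
      congr 1
      simp
    · congr 1
      norm_cast
      simp
  have hint₀ : Integrable fun w : V => Real.exp (-(π ^ 2 * c) * ‖w‖ ^ 2) := by
    have h1 : 0 < ((π ^ 2 * c : ℝ) : ℂ).re := by
      rw [Complex.ofReal_re]
      positivity
    refine (GaussianFourier.integrable_cexp_neg_mul_sq_norm_add h1 0 (0 : V)).norm.congr
      (ae_of_all _ fun w => ?_)
    dsimp only
    rw [Complex.norm_exp, zero_mul, add_zero]
    norm_cast
  have hint : Integrable fun w : V => Real.exp (-(π ^ 2 * c) * ‖v - w‖ ^ 2) :=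
    hint₀.comp_sub_left v
  have hval : ∫ w : V, (π * c) ^ (Module.finrank ℝ V / 2 : ℝ) *
      Real.exp (-(π ^ 2 * c) * ‖v - w‖ ^ 2) = 1 := by
    rw [integral_const_mul, integral_sub_left_eq_self
      (fun w : V => Real.exp (-(π ^ 2 * c) * ‖w‖ ^ 2)) volume v,
      GaussianFourier.integral_rexp_neg_mul_sq_norm (by positivity), ← Real.mul_rpow
      (by positivity) (by positivity)]
    rw [show π * c * (π / (π ^ 2 * c)) = 1 by field_simp, Real.one_rpow]
  calc _ ≤ ∫ w : V, ((π * c) ^ (Module.finrank ℝ V / 2 : ℝ) *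
        Real.exp (-(π ^ 2 * c) * ‖v - w‖ ^ 2)) * M := by
        refine norm_integral_le_of_norm_le ((hint.const_mul _).mul_const _)
          (ae_of_all _ fun w => ?_)
        rw [norm_smul, hnorm]
        gcongr
        exact hM w
    _ = M := by rw [integral_mul_const, hval, one_mul]

theorem continuous_fourier {Ψ : V → ℂ} (hΨ : Integrable Ψ) : Continuous (𝓕 Ψ) :=
  VectorFourier.fourierIntegral_continuous Real.continuous_fourierChar
    (innerSL ℝ : V →L[ℝ] V →L[ℝ] ℝ).continuous₂ hΨ

open Real Complex Filter Topology in
/-- A Fourier multiplier acts as convolution with its kernel, at the level of absolute values. -/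
theorem enorm_fourierInv_mul_le {Ψ H : V → ℂ} (hΨ : Integrable Ψ) {M : ℝ} (hM : ∀ w, ‖Ψ w‖ ≤ M)
    (hcont : ∀ᵐ v, ContinuousAt Ψ v) (hH : Integrable H) (x : V) :
    ‖𝓕⁻ (fun v => Ψ v * H v) x‖ₑ ≤ ∫⁻ y, ‖𝓕⁻ Ψ (x - y)‖ₑ * ‖𝓕⁻ H y‖ₑ := by
  set R := ∫⁻ y, ‖𝓕⁻ Ψ (x - y)‖ₑ * ‖𝓕⁻ H y‖ₑ with hR
  set Ψc : ℝ → V → ℂ := fun c v => ∫ w : V, ((π * c : ℂ) ^ (Module.finrank ℝ V / 2 : ℂ) *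
        cexp (-π ^ 2 * c * ‖v - w‖ ^ 2)) • Ψ w with hΨc
  have hlim : Tendsto (fun c : ℝ => ∫ v, 𝐞 ⟪v, x⟫ • (Ψc c v * H v)) atTop
      (𝓝 (𝓕⁻ (fun v => Ψ v * H v) x)) := by
    rw [Real.fourierInv_eq]
    refine tendsto_integral_filter_of_dominated_convergence (fun v => M * ‖H v‖) ?_ ?_
      (hH.norm.const_mul _) ?_
    · refine Eventually.of_forall fun c => ?_
      have h1 : AEStronglyMeasurable (Ψc c) := by
        refine AEStronglyMeasurable.integral_prod_right' (f := fun z : V × V =>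
          ((π * c : ℂ) ^ (Module.finrank ℝ V / 2 : ℂ) *
            cexp (-π ^ 2 * c * ‖z.1 - z.2‖ ^ 2)) • Ψ z.2) ?_
        have h3 : Continuous fun z : V × V => (π * c : ℂ) ^ (Module.finrank ℝ V / 2 : ℂ) *
            cexp (-π ^ 2 * c * ‖z.1 - z.2‖ ^ 2) := by fun_prop
        exact h3.aestronglyMeasurable.smul hΨ.1.comp_snd
      have h2 : Continuous fun v : V => 𝐞 ⟪v, x⟫ :=
        Real.continuous_fourierChar.comp (by fun_prop)
      exact h2.aestronglyMeasurable.smul (h1.mul hH.1)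
    · filter_upwards [Ioi_mem_atTop 0] with c hc
      refine ae_of_all _ fun v => ?_
      rw [Circle.norm_smul, norm_mul]
      gcongr
      exact norm_integral_gaussian_smul_le hM hc v
    · filter_upwards [hcont] with v hv
      exact ((Real.tendsto_integral_gaussian_smul' hΨ hv).mul_const _).const_smul _
  refine le_of_tendsto hlim.enorm ?_
  filter_upwards [Ioi_mem_atTop 0] with c hc
  have key : ∫ v, 𝐞 ⟪v, x⟫ • (Ψc c v * H v) =
      ∫ w, cexp (-c⁻¹ * ‖w‖ ^ 2) * 𝓕 Ψ w * 𝓕⁻ H (x + w) := by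
    have hg : Integrable fun w : V => cexp (-c⁻¹ * ‖w‖ ^ 2) * 𝓕 Ψ w := by
      refine Integrable.mul_bdd (c := ∫ v, ‖Ψ v‖) ?_ (continuous_fourier hΨ).aestronglyMeasurable
        (ae_of_all _ fun w => VectorFourier.norm_fourierIntegral_le_integral_norm _ _ _ _ _)
      simpa using GaussianFourier.integrable_cexp_neg_mul_sq_norm_add (V := V)
        (b := (c⁻¹ : ℂ)) (by simpa) 0 0
    have hprod : Integrable (fun z : V × V => 𝐞 ⟪z.1, x⟫ • ((cexp (2 * π * I * ⟪z.1, z.2⟫) *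
        (cexp (-c⁻¹ * ‖z.2‖ ^ 2) * 𝓕 Ψ z.2)) * H z.1)) (volume.prod volume) := by
      refine (hH.mul_prod hg).mono ?_ (ae_of_all _ fun z => le_of_eq ?_)
      · have h2 : Continuous fun z : V × V => 𝐞 ⟪z.1, x⟫ :=
          Real.continuous_fourierChar.comp (by fun_prop)
        refine h2.aestronglyMeasurable.smul (AEStronglyMeasurable.mul (AEStronglyMeasurable.mul
          (Continuous.aestronglyMeasurable (by fun_prop)) hg.1.comp_snd) hH.1.comp_fst)
      · rw [Circle.norm_smul, norm_mul, norm_mul, norm_mul,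
          show (2 * π * I * ⟪z.1, z.2⟫ : ℂ) = ((2 * π * ⟪z.1, z.2⟫ : ℝ) : ℂ) * I by
            push_cast; ring, Complex.norm_exp_ofReal_mul_I, one_mul, mul_comm, norm_mul, norm_mul]
    calc _ = ∫ v, ∫ w, 𝐞 ⟪v, x⟫ • ((cexp (2 * π * I * ⟪v, w⟫) *
          (cexp (-c⁻¹ * ‖w‖ ^ 2) * 𝓕 Ψ w)) * H v) := by
          congr with v
          rw [hΨc]
          dsimp only
          rw [← integral_gaussian_mul_fourier_eq hΨ hc, ← integral_mul_const,
            Circle.smul_def, ← integral_smul]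
          congr with w
          rw [add_comm, Complex.exp_add, mul_assoc (cexp _) (cexp _), Circle.smul_def]
      _ = ∫ w, ∫ v, 𝐞 ⟪v, x⟫ • ((cexp (2 * π * I * ⟪v, w⟫) *
          (cexp (-c⁻¹ * ‖w‖ ^ 2) * 𝓕 Ψ w)) * H v) := integral_integral_swap hprod
      _ = _ := by
          congr with w
          rw [Real.fourierInv_eq, ← integral_const_mul]
          congr with v
          rw [inner_add_right, AddChar.map_add_eq_mul, mul_smul, Circle.smul_def
            (𝐞 ⟪v, w⟫), Real.fourierChar_apply, Circle.smul_def, Circle.smul_def]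
          simp only [smul_eq_mul]
          push_cast
          ring_nf
  rw [key]
  refine (enorm_integral_le_lintegral_enorm _).trans ?_
  rw [hR, ← lintegral_add_left_eq_self (fun y => ‖𝓕⁻ Ψ (x - y)‖ₑ * ‖𝓕⁻ H y‖ₑ) x]
  refine lintegral_mono fun w => ?_
  rw [enorm_mul, enorm_mul, sub_add_cancel_left, Real.fourierInv_eq_fourier_neg Ψ, neg_neg]
  gcongr
  refine mul_le_of_le_one_left' ?_
  rw [← ofReal_norm, Complex.norm_exp]
  norm_cast
  rw [ENNReal.ofReal_le_one, Real.exp_le_one_iff]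
  have : 0 < c⁻¹ := inv_pos.2 hc
  simp only [neg_mul, Left.neg_nonpos_iff]
  positivity

end GaussRegularization

theorem integrableOn_pow_mul_exp_neg_sq (j : ℕ) :
    IntegrableOn (fun x : ℝ => x ^ j * Real.exp (-x ^ 2)) (Set.Ioi 0) := by
  have := integrableOn_rpow_mul_exp_neg_mul_sq (b := 1) one_pos (s := (j : ℝ))
    (by have : (0 : ℝ) ≤ j := j.cast_nonneg
        linarith)
  simpa using this

theorem norm_cexp_neg_sq_sub_le {c : ℂ} (hc : 0 ≤ c.re) {x : ℝ} (hx : 0 ≤ x) :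
    ‖Complex.exp (-x ^ 2 - c * x)‖ ≤ Real.exp (-x ^ 2) := by
  rw [Complex.norm_exp, Real.exp_le_exp]
  have h1 : (-(x : ℂ) ^ 2 - c * x).re = -x ^ 2 - c.re * x := by
    simp [← Complex.ofReal_pow]
  rw [h1]
  have : 0 ≤ c.re * x := by positivity
  linarith

theorem integrableOn_pow_mul_cexp_neg_sq_sub {c : ℂ} (hc : 0 ≤ c.re) (j : ℕ) :
    IntegrableOn (fun x : ℝ => (x : ℂ) ^ j * Complex.exp (-x ^ 2 - c * x)) (Set.Ioi 0) := by
  refine Integrable.mono' (integrableOn_pow_mul_exp_neg_sq j)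
    (Continuous.aestronglyMeasurable (by fun_prop)) ?_
  filter_upwards [ae_restrict_mem measurableSet_Ioi] with x hx
  have hx : 0 < x := hx
  rw [norm_mul, norm_pow, Complex.norm_of_nonneg hx.le]
  gcongr
  exact norm_cexp_neg_sq_sub_le hc hx.le

theorem norm_integral_pow_mul_cexp_neg_sq_sub_le {c : ℂ} (hc : 0 ≤ c.re) (j : ℕ) :
    ‖∫ x in Set.Ioi (0 : ℝ), (x : ℂ) ^ j * Complex.exp (-x ^ 2 - c * x)‖ ≤
      ∫ x in Set.Ioi (0 : ℝ), x ^ j * Real.exp (-x ^ 2) := by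
  refine norm_integral_le_of_norm_le (integrableOn_pow_mul_exp_neg_sq j) ?_
  filter_upwards [ae_restrict_mem measurableSet_Ioi] with x hx
  have hx : 0 < x := hx
  rw [norm_mul, norm_pow, Complex.norm_of_nonneg hx.le]
  gcongr
  exact norm_cexp_neg_sq_sub_le hc hx.le

theorem tendsto_pow_mul_cexp_neg_sq_sub {c : ℂ} (hc : 0 ≤ c.re) (j : ℕ) :
    Filter.Tendsto (fun x : ℝ => (x : ℂ) ^ j * Complex.exp (-x ^ 2 - c * x)) Filter.atTop
      (nhds 0) := by
  refine squeeze_zero_norm' ?_ (Real.tendsto_pow_mul_exp_neg_atTop_nhds_zero j)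
  filter_upwards [Filter.eventually_ge_atTop 1] with x hx
  have hx0 : 0 ≤ x := by linarith
  rw [norm_mul, norm_pow, Complex.norm_of_nonneg hx0]
  gcongr
  refine (norm_cexp_neg_sq_sub_le hc hx0).trans ?_
  rw [Real.exp_le_exp]
  nlinarith

theorem norm_mul_integral_pow_mul_cexp_neg_sq_sub_le (j : ℕ) :
    ∃ A : ℝ, 0 < A ∧ ∀ c : ℂ, 0 ≤ c.re →
      (1 + ‖c‖) * ‖∫ x in Set.Ioi (0 : ℝ), (x : ℂ) ^ j * Complex.exp (-x ^ 2 - c * x)‖ ≤ A := by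
  set N : ℕ → ℝ := fun j => ∫ x in Set.Ioi (0 : ℝ), x ^ j * Real.exp (-x ^ 2) with hN
  have hN0 : ∀ j, 0 ≤ N j := fun j => setIntegral_nonneg measurableSet_Ioi fun x hx => by
    have : 0 < x := hx
    positivity
  refine ⟨N j + (1 + (j * N (j - 1) + 2 * N (j + 1))), ?_, fun c hc => ?_⟩
  · have := hN0 j
    have := hN0 (j - 1)
    have := hN0 (j + 1)
    positivity
  set I : ℕ → ℂ := fun j => ∫ x in Set.Ioi (0 : ℝ), (x : ℂ) ^ j * Complex.exp (-x ^ 2 - c * x)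
    with hI
  have hIN : ∀ j, ‖I j‖ ≤ N j := norm_integral_pow_mul_cexp_neg_sq_sub_le hc
  have hi := integrableOn_pow_mul_cexp_neg_sq_sub hc
  have key : j * I (j - 1) - 2 * I (j + 1) - c * I j = -(0 : ℂ) ^ j := by
    have h1 := integral_Ioi_of_hasDerivAt_of_tendsto' (a := 0)
      (f := fun x : ℝ => (x : ℂ) ^ j * Complex.exp (-x ^ 2 - c * x))
      (f' := fun x : ℝ => j * ((x : ℂ) ^ (j - 1) * Complex.exp (-x ^ 2 - c * x)) -
        2 * ((x : ℂ) ^ (j + 1) * Complex.exp (-x ^ 2 - c * x)) -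
        c * ((x : ℂ) ^ j * Complex.exp (-x ^ 2 - c * x))) (fun x _ => ?_)
      ((((hi (j - 1)).const_mul _).sub ((hi (j + 1)).const_mul _)).sub ((hi j).const_mul _))
      (tendsto_pow_mul_cexp_neg_sq_sub hc j)
    · rw [integral_sub, integral_sub, integral_const_mul, integral_const_mul,
        integral_const_mul] at h1
      · simpa using h1
      · exact (hi (j - 1)).const_mul _
      · exact (hi (j + 1)).const_mul _
      · exact ((hi (j - 1)).const_mul _).sub ((hi (j + 1)).const_mul _)
      · exact (hi j).const_mul _
    · have hid : HasDerivAt (fun x : ℝ => (x : ℂ)) 1 x := Complex.ofRealCLM.hasDerivAt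
      have h2 := (hid.pow j).mul (((hid.pow 2).neg.sub (hid.const_mul c)).cexp)
      refine h2.congr_deriv ?_
      simp only [Pi.pow_apply, Pi.neg_apply, Pi.sub_apply]
      push_cast
      ring
  have h2 : c * I j = 0 ^ j + (j * I (j - 1) - 2 * I (j + 1)) := by linear_combination -key
  have h3 : ‖c‖ * ‖I j‖ ≤ 1 + (j * N (j - 1) + 2 * N (j + 1)) := by
    rw [← norm_mul, h2]
    refine (norm_add_le _ _).trans (add_le_add ?_ ((norm_sub_le _ _).trans (add_le_add ?_ ?_)))
    · rw [norm_pow, norm_zero]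
      exact pow_le_one₀ le_rfl zero_le_one
    · rw [norm_mul, Complex.norm_natCast]
      gcongr
      exact hIN _
    · rw [norm_mul, Complex.norm_ofNat]
      gcongr
      exact hIN _
  have := hIN j
  rw [add_mul, one_mul]
  linarith

theorem norm_integral_pow_mul_cexp_scaled_le (j : ℕ) :
    ∃ A : ℝ, 0 < A ∧ ∀ r b y : ℝ, 0 < r → 0 ≤ b →
      ‖∫ x in Set.Ioi (0 : ℝ), (x : ℂ) ^ j * Complex.exp (-(r * x) ^ 2 - (b - 2 * Real.pi * y *
        Complex.I) * x)‖ ≤ A * (r⁻¹) ^ j * (r + |y|)⁻¹ := by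
  obtain ⟨A, hA, h⟩ := norm_mul_integral_pow_mul_cexp_neg_sq_sub_le j
  refine ⟨A, hA, fun r b y hr hb => ?_⟩
  set c : ℂ := (b - 2 * Real.pi * y * Complex.I) / r with hc
  have hrc : (r : ℂ) ≠ 0 := by exact_mod_cast hr.ne'
  have hcre : 0 ≤ c.re := by
    rw [hc, Complex.div_ofReal_re]
    have : (b - 2 * Real.pi * y * Complex.I : ℂ).re = b := by simp
    rw [this]
    positivity
  have hcn : |y| / r ≤ ‖c‖ := by
    have h1 : c.im = -(2 * Real.pi * y) / r := by
      rw [hc, Complex.div_ofReal_im]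
      congr 1
      simp
    refine le_trans ?_ (Complex.abs_im_le_norm c)
    rw [h1, abs_div, abs_neg, abs_mul, abs_of_pos hr, abs_of_pos Real.two_pi_pos]
    gcongr
    have : 1 ≤ 2 * Real.pi := by linarith [Real.pi_gt_three]
    nlinarith [abs_nonneg y]
  have h1 := integral_comp_mul_left_Ioi
    (fun x : ℝ => ((r⁻¹ * x : ℝ) : ℂ) ^ j * Complex.exp (-x ^ 2 - c * x)) 0 hr
  have h2 : ∫ x in Set.Ioi (0 : ℝ), (x : ℂ) ^ j * Complex.exp (-(r * x) ^ 2 - (b - 2 * Real.pi *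
      y * Complex.I) * x) = (r⁻¹ : ℂ) ^ (j + 1) *
        ∫ x in Set.Ioi (0 : ℝ), (x : ℂ) ^ j * Complex.exp (-x ^ 2 - c * x) := by
    calc _ = ∫ x in Set.Ioi (0 : ℝ), ((r⁻¹ * (r * x) : ℝ) : ℂ) ^ j *
          Complex.exp (-(r * x : ℝ) ^ 2 - c * (r * x : ℝ)) := by
          congr with x
          rw [inv_mul_cancel_left₀ hr.ne', hc]
          congr 3
          · push_cast; ring
          · push_cast; field_simp
      _ = _ := by
          rw [h1, mul_zero, pow_succ', mul_assoc, ← integral_const_mul]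
          rw [Complex.real_smul, Complex.ofReal_inv]
          congr 2 with x
          push_cast
          ring
  have h3 := h c hcre
  rw [h2, norm_mul, norm_pow, norm_inv, Complex.norm_of_nonneg hr.le]
  have h4 : (1 + |y| / r) * ‖∫ x in Set.Ioi (0 : ℝ), (x : ℂ) ^ j *
      Complex.exp (-x ^ 2 - c * x)‖ ≤ A := le_trans (by gcongr) h3
  have h5 : r⁻¹ * ‖∫ x in Set.Ioi (0 : ℝ), (x : ℂ) ^ j * Complex.exp (-x ^ 2 - c * x)‖ ≤
      A * (r + |y|)⁻¹ := by
    rw [← div_eq_mul_inv, le_div_iff₀ (by positivity)]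
    refine le_trans (le_of_eq ?_) h4
    field_simp
  calc _ = r⁻¹ ^ j * (r⁻¹ * ‖∫ x in Set.Ioi (0 : ℝ), (x : ℂ) ^ j *
        Complex.exp (-x ^ 2 - c * x)‖) := by ring
    _ ≤ r⁻¹ ^ j * (A * (r + |y|)⁻¹) := by gcongr
    _ = _ := by ring

/-- The function `x ^ j * exp (-r² x² - b |x|)` cut off to the half line `0 ≤ x` (for `s = true`)
or `x < 0` (for `s = false`). -/
noncomputable def halfGaussian (s : Bool) (j : ℕ) (b r x : ℝ) : ℝ :=
  if (s = true ↔ 0 ≤ x) then x ^ j * Real.exp (-(r * x) ^ 2 - b * |x|) else 0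

theorem measurable_halfGaussian (s : Bool) (j : ℕ) (b r : ℝ) :
    Measurable (halfGaussian s j b r) := by
  unfold halfGaussian
  refine Measurable.ite ?_ (by fun_prop) measurable_const
  cases s
  · simp only [Bool.false_eq_true, false_iff, not_le]
    exact measurableSet_Iio
  · simp only [true_iff]
    exact measurableSet_Ici

theorem continuousAt_halfGaussian (s : Bool) (j : ℕ) (b r : ℝ) {x : ℝ} (hx : x ≠ 0) :
    ContinuousAt (halfGaussian s j b r) x := by
  have h1 : Continuous fun x : ℝ => x ^ j * Real.exp (-(r * x) ^ 2 - b * |x|) := by fun_prop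
  have h2 : ∀ᶠ y in nhds x, (0 ≤ y ↔ 0 ≤ x) := by
    rcases hx.lt_or_gt with h | h
    · filter_upwards [eventually_lt_nhds h] with y hy
      simp [hy.not_ge, h.not_ge]
    · filter_upwards [eventually_gt_nhds h] with y hy
      simp [hy.le, h.le]
  by_cases h3 : (s = true ↔ 0 ≤ x)
  · refine h1.continuousAt.congr ?_
    filter_upwards [h2] with y hy
    rw [halfGaussian, if_pos (h3.trans hy.symm)]
  · refine (continuousAt_const (y := (0 : ℝ))).congr ?_
    filter_upwards [h2] with y hy
    rw [halfGaussian, if_neg fun h => h3 (h.trans hy)]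

theorem abs_halfGaussian_le (s : Bool) (j : ℕ) {b : ℝ} (hb : 0 ≤ b) (r x : ℝ) :
    |halfGaussian s j b r x| ≤ |x ^ j * Real.exp (-r ^ 2 * x ^ 2)| := by
  unfold halfGaussian
  split_ifs
  · rw [abs_mul, abs_mul, Real.abs_exp, Real.abs_exp]
    gcongr
    have : 0 ≤ b * |x| := by positivity
    nlinarith
  · rw [abs_zero]
    exact abs_nonneg _

theorem integrable_halfGaussian (s : Bool) (j : ℕ) {b r : ℝ} (hb : 0 ≤ b) (hr : 0 < r) :
    Integrable (halfGaussian s j b r) := by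
  have h := integrable_rpow_mul_exp_neg_mul_sq (b := r ^ 2) (by positivity) (s := (j : ℝ))
    (by have : (0 : ℝ) ≤ j := j.cast_nonneg
        linarith)
  simp only [Real.rpow_natCast] at h
  exact h.mono (measurable_halfGaussian s j b r).aestronglyMeasurable
    (ae_of_all _ (abs_halfGaussian_le s j hb r))

theorem exists_abs_halfGaussian_le (s : Bool) (j : ℕ) {b r : ℝ} (hb : 0 ≤ b) (hr : 0 < r) :
    ∃ M, ∀ x, |halfGaussian s j b r x| ≤ M := by
  refine ⟨(r⁻¹) ^ j * (j.factorial * Real.exp 1), fun x =>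
    (abs_halfGaussian_le s j hb r x).trans ?_⟩
  have h1 := Real.pow_div_factorial_le_exp (r * |x|) (by positivity) j
  rw [div_le_iff₀ (by positivity)] at h1
  rw [abs_mul, Real.abs_exp, abs_pow]
  calc |x| ^ j * Real.exp (-r ^ 2 * x ^ 2)
      = (r⁻¹) ^ j * ((r * |x|) ^ j * Real.exp (-r ^ 2 * x ^ 2)) := by
        rw [mul_pow, inv_pow]
        field_simp
    _ ≤ (r⁻¹) ^ j * ((Real.exp (r * |x|) * j.factorial) * Real.exp (-r ^ 2 * x ^ 2)) := by gcongr
    _ = (r⁻¹) ^ j * (j.factorial * Real.exp (r * |x| + -r ^ 2 * x ^ 2)) := by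
        rw [Real.exp_add]
        ring
    _ ≤ _ := by
        gcongr
        rw [← sq_abs x]
        nlinarith [sq_nonneg (r * |x| - 1)]

theorem enorm_integral_halfGaussian_le (j : ℕ) :
    ∃ A : ℝ, 0 < A ∧ ∀ (s : Bool) (r b y : ℝ), 0 < r → 0 ≤ b →
      ‖∫ x : ℝ, Complex.exp (2 * Real.pi * y * Complex.I * x) * halfGaussian s j b r x‖ₑ ≤
        ENNReal.ofReal (A * (r⁻¹) ^ j) * (ENNReal.ofReal r + ‖y‖ₑ)⁻¹ := by
  obtain ⟨A, hA, h⟩ := norm_integral_pow_mul_cexp_scaled_le j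
  refine ⟨A, hA, fun s r b y hr hb => ?_⟩
  have h1 : (ENNReal.ofReal r + ‖y‖ₑ)⁻¹ = ENNReal.ofReal ((r + |y|)⁻¹) := by
    rw [ENNReal.ofReal_inv_of_pos (by positivity), ENNReal.ofReal_add hr.le (abs_nonneg _),
      ← Real.norm_eq_abs, ofReal_norm]
  rw [h1, ← ENNReal.ofReal_mul (by positivity), ← ofReal_norm]
  apply ENNReal.ofReal_le_ofReal
  cases s
  · have h2 := h r b (-y) hr hb
    rw [abs_neg] at h2
    refine le_trans (le_of_eq ?_) h2
    have h3 : (fun x : ℝ => Complex.exp (2 * Real.pi * y * Complex.I * x) *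
        halfGaussian false j b r x) = (Set.Iio 0).indicator fun x : ℝ => (-1 : ℂ) ^ j *
          (((-x : ℝ) : ℂ) ^ j * Complex.exp (-(r * (-x : ℝ)) ^ 2 - (b - 2 * Real.pi * (-y : ℝ) *
          Complex.I) * (-x : ℝ))) := by
      ext x
      by_cases hx : x < 0
      · rw [Set.indicator_of_mem (show x ∈ Set.Iio 0 from hx), halfGaussian,
          if_pos (by simpa using hx), abs_of_neg hx]
        push_cast
        rw [← mul_assoc ((-1 : ℂ) ^ j), ← mul_pow, mul_left_comm, ← Complex.exp_add]
        congr 2 <;> ring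
      · rw [Set.indicator_of_notMem (show x ∉ Set.Iio 0 from hx), halfGaussian,
          if_neg (by simpa using hx)]
        simp
    rw [h3, integral_indicator measurableSet_Iio, integral_const_mul, norm_mul, norm_pow,
      norm_neg, norm_one, one_pow, one_mul, ← integral_Iic_eq_integral_Iio]
    have h4 := integral_comp_neg_Iic (0 : ℝ) (fun x : ℝ => (x : ℂ) ^ j * Complex.exp
      (-(r * x) ^ 2 - (b - 2 * Real.pi * (-y : ℝ) * Complex.I) * x))
    rw [neg_zero] at h4
    rw [h4]
  · refine le_trans (le_of_eq ?_) (h r b y hr hb)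
    have h3 : (fun x : ℝ => Complex.exp (2 * Real.pi * y * Complex.I * x) *
        halfGaussian true j b r x) = (Set.Ici 0).indicator fun x : ℝ =>
          ((x : ℂ) ^ j * Complex.exp (-(r * x) ^ 2 - (b - 2 * Real.pi * y *
          Complex.I) * x)) := by
      ext x
      by_cases hx : 0 ≤ x
      · rw [Set.indicator_of_mem (show x ∈ Set.Ici 0 from hx), halfGaussian,
          if_pos (by simpa using hx), abs_of_nonneg hx]
        push_cast
        rw [mul_left_comm, ← Complex.exp_add]
        congr 2
        ring
      · rw [Set.indicator_of_notMem (show x ∉ Set.Ici 0 from hx), halfGaussian,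
          if_neg (by simpa using hx)]
        simp
    rw [h3, integral_indicator measurableSet_Ici, integral_Ici_eq_integral_Ioi]

/-- A bounded integrable multiplier whose kernel is dominated by `A · prodCauchy r`. -/
structure KernelBound {d : ℕ} (Ψ : EuclideanSpace ℝ (Fin d) → ℂ) (A : ℝ≥0∞) (r : ℝ) : Prop where
  measurable : Measurable Ψ
  integrable : Integrable Ψ
  bounded : ∃ M : ℝ, ∀ w, ‖Ψ w‖ ≤ M
  continuousAt : ∀ᵐ v, ContinuousAt Ψ v
  enorm_le : ∀ x, ‖𝓕⁻ Ψ x‖ₑ ≤ A * prodCauchy r x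

theorem exists_kernelBound_prod_halfGaussian {d : ℕ} (j : Fin d → ℕ) :
    ∃ A : ℝ, 0 < A ∧ ∀ (s : Fin d → Bool) (b : Fin d → ℝ) (r : ℝ), (∀ i, 0 ≤ b i) → 0 < r →
      KernelBound (fun ξ : EuclideanSpace ℝ (Fin d) =>
          ∏ i, (halfGaussian (s i) (j i) (b i) r (ξ i) : ℂ))
        (ENNReal.ofReal (A * r⁻¹ ^ ∑ i, j i)) r := by
  choose A hA h using fun i => enorm_integral_halfGaussian_le (j i)
  refine ⟨∏ i, A i, Finset.prod_pos fun i _ => hA i, fun s b r hb hr => ?_⟩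
  have hmp := PiLp.volume_preserving_toLp (Fin d)
  have hemb : MeasurableEmbedding (WithLp.toLp 2 : (Fin d → ℝ) → EuclideanSpace ℝ (Fin d)) :=
    (MeasurableEquiv.toLp 2 (Fin d → ℝ)).measurableEmbedding
  refine ⟨?_, ?_, ?_, ?_, fun x => ?_⟩
  · refine Finset.measurable_prod _ fun i _ => ?_
    have := measurable_halfGaussian (s i) (j i) (b i) r
    fun_prop
  · rw [← hmp.integrable_comp_emb hemb]
    exact Integrable.fintype_prod
      (f := fun i (y : ℝ) => (halfGaussian (s i) (j i) (b i) r y : ℂ))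
      fun i => (integrable_halfGaussian (s i) (j i) (hb i) hr).ofReal
  · choose M hM using fun i => exists_abs_halfGaussian_le (s i) (j i) (hb i) hr
    refine ⟨∏ i, M i, fun w => ?_⟩
    rw [norm_prod]
    refine Finset.prod_le_prod (fun i _ => norm_nonneg _) fun i _ => ?_
    rw [Complex.norm_real]
    exact hM i _
  · have h1 : ∀ᵐ v : EuclideanSpace ℝ (Fin d), ∀ i, v i ≠ 0 := by
      rw [← hmp.map_eq, hemb.ae_map_iff, ae_all_iff]
      intro i
      have h2 : ∀ᵐ y : Fin d → ℝ, y i ≠ 0 := Measure.ae_eval_ne (fun _ => volume) i 0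
      exact h2
    filter_upwards [h1] with v hv
    refine tendsto_finsetProd _ fun i _ => ?_
    have h2 : ContinuousAt (fun ξ : EuclideanSpace ℝ (Fin d) => ξ i) v := by fun_prop
    exact Complex.continuous_ofReal.continuousAt.comp
      (ContinuousAt.comp (f := fun ξ : EuclideanSpace ℝ (Fin d) => ξ i)
        (continuousAt_halfGaussian (s i) (j i) (b i) r (hv i)) h2)
  · have h1 : 𝓕⁻ (fun ξ : EuclideanSpace ℝ (Fin d) =>
          ∏ i, (halfGaussian (s i) (j i) (b i) r (ξ i) : ℂ)) x =
        ∏ i, ∫ y : ℝ, Complex.exp (2 * Real.pi * (x i) * Complex.I * y) *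
          halfGaussian (s i) (j i) (b i) r y := by
      rw [Real.fourierInv_eq', ← hmp.integral_comp hemb, ← integral_fintype_prod_volume_eq_prod
        (f := fun i (y : ℝ) => Complex.exp (2 * Real.pi * (x i) * Complex.I * y) *
          halfGaussian (s i) (j i) (b i) r y)]
      congr with v
      rw [Finset.prod_mul_distrib, ← Complex.exp_sum, smul_eq_mul, PiLp.inner_apply]
      congr 2
      simp only [RCLike.inner_apply, conj_trivial]
      push_cast
      rw [Finset.mul_sum, Finset.sum_mul]
      exact Finset.sum_congr rfl fun i _ => by ring
    rw [h1, ← ofReal_norm, norm_prod, ENNReal.ofReal_prod_of_nonneg fun i _ => norm_nonneg _,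
      ← Finset.prod_pow_eq_pow_sum, ← Finset.prod_mul_distrib,
      ENNReal.ofReal_prod_of_nonneg fun i _ => mul_nonneg (hA i).le (by positivity), prodCauchy,
      ← Finset.prod_mul_distrib]
    refine Finset.prod_le_prod' fun i _ => ?_
    rw [ofReal_norm]
    exact h i (s i) r (b i) (x i) hr (hb i)

section Bilinear

variable {V : Type*} [NormedAddCommGroup V] [InnerProductSpace ℝ V] [MeasurableSpace V]
  [BorelSpace V] [FiniteDimensional ℝ V]

theorem integrable_comp_add_mul_iff {G u v : V → ℂ} :
    Integrable (fun z : V × V => G z.2 * (u z.1 * v (z.2 - z.1))) ↔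
      Integrable (fun z : V × V => G (z.1 + z.2) * (u z.1 * v z.2)) := by
  have hmp := measurePreserving_prod_add (volume : Measure V) (volume : Measure V)
  rw [Measure.volume_eq_prod, ← hmp.integrable_comp_emb
    (MeasurableEquiv.shearAddRight V).measurableEmbedding]
  simp [Function.comp_def]

theorem integral_comp_add_mul {G u v : V → ℂ}
    (h : Integrable (fun z : V × V => G (z.1 + z.2) * (u z.1 * v z.2))) :
    ∫ z : V × V, G (z.1 + z.2) * (u z.1 * v z.2) =
      ∫ ζ, G ζ * ∫ ξ, u ξ * v (ζ - ξ) := by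
  have hmp := measurePreserving_prod_add (volume : Measure V) (volume : Measure V)
  have h' := integrable_comp_add_mul_iff.2 h
  have h1 := hmp.integral_comp (MeasurableEquiv.shearAddRight V).measurableEmbedding
    (fun z : V × V => G z.2 * (u z.1 * v (z.2 - z.1)))
  simp only [add_sub_cancel_left] at h1
  rw [Measure.volume_eq_prod] at h' ⊢
  rw [h1, integral_prod_symm _ h']
  simp_rw [integral_const_mul]

end Bilinear

/-- Integrating a bounded symbol against `φ ⊗ ψ` over the frequency variables. -/
noncomputable def bilinMul {d : ℕ} (m : EuclideanSpace ℝ (Fin d) × EuclideanSpace ℝ (Fin d) → ℂ)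
    (φ ψ : EuclideanSpace ℝ (Fin d) → ℂ) (x : EuclideanSpace ℝ (Fin d)) : ℂ :=
  ∫ z : EuclideanSpace ℝ (Fin d) × EuclideanSpace ℝ (Fin d),
    Complex.exp ((2 * Real.pi * ⟪z.1 + z.2, x⟫ : ℝ) * Complex.I) * (m z * (φ z.1 * ψ z.2))

/-- The positive operator that dominates the bilinear multipliers below. -/
noncomputable def cauchyConv {d : ℕ} (t r ρ : ℝ) (F G : EuclideanSpace ℝ (Fin d) → ℝ≥0∞) :
    EuclideanSpace ℝ (Fin d) → ℝ≥0∞ :=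
  posConv (prodCauchy t) fun y => posConv (prodCauchy r) F y * posConv (prodCauchy ρ) G y

/-- A bounded symbol whose bilinear operator is dominated by `A · cauchyConv t r ρ`. -/
structure SymbolBound {d : ℕ} (t r ρ : ℝ) (A : ℝ≥0∞)
    (m : EuclideanSpace ℝ (Fin d) × EuclideanSpace ℝ (Fin d) → ℂ) : Prop where
  measurable : Measurable m
  bounded : ∃ M : ℝ, ∀ z, ‖m z‖ ≤ M
  enorm_le : ∀ φ ψ : EuclideanSpace ℝ (Fin d) → ℂ, Integrable φ → Integrable ψ → ∀ x,
    ‖bilinMul m φ ψ x‖ₑ ≤ A * cauchyConv t r ρ (fun y => ‖𝓕⁻ φ y‖ₑ) (fun y => ‖𝓕⁻ ψ y‖ₑ) x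

section

variable {d : ℕ} {t r ρ : ℝ} {A B : ℝ≥0∞}
  {m n : EuclideanSpace ℝ (Fin d) × EuclideanSpace ℝ (Fin d) → ℂ}

theorem norm_cexp_mul_I (y : ℝ) : ‖Complex.exp ((y : ℂ) * Complex.I)‖ = 1 :=
  Complex.norm_exp_ofReal_mul_I y

theorem integrable_bilinMul {M : ℝ} (hm : Measurable m) (hM : ∀ z, ‖m z‖ ≤ M)
    {φ ψ : EuclideanSpace ℝ (Fin d) → ℂ} (hφ : Integrable φ) (hψ : Integrable ψ)
    (x : EuclideanSpace ℝ (Fin d)) :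
    Integrable fun z : EuclideanSpace ℝ (Fin d) × EuclideanSpace ℝ (Fin d) =>
      Complex.exp ((2 * Real.pi * ⟪z.1 + z.2, x⟫ : ℝ) * Complex.I) *
        (m z * (φ z.1 * ψ z.2)) := by
  refine Integrable.bdd_mul (c := 1) (Integrable.bdd_mul (c := M) (hφ.mul_prod hψ)
    hm.aestronglyMeasurable (ae_of_all _ hM)) ?_ (ae_of_all _ fun z => (norm_cexp_mul_I _).le)
  exact Continuous.aestronglyMeasurable (by fun_prop)

theorem SymbolBound.mono (h : SymbolBound t r ρ A m) (hAB : A ≤ B) : SymbolBound t r ρ B m :=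
  ⟨h.measurable, h.bounded, fun φ ψ hφ hψ x => (h.enorm_le φ ψ hφ hψ x).trans (by gcongr)⟩

theorem SymbolBound.zero : SymbolBound t r ρ 0
    (fun _ : EuclideanSpace ℝ (Fin d) × EuclideanSpace ℝ (Fin d) => 0) :=
  ⟨measurable_const, ⟨0, by simp⟩, fun φ ψ _ _ x => by simp [bilinMul]⟩

theorem SymbolBound.add (hm : SymbolBound t r ρ A m) (hn : SymbolBound t r ρ B n) :
    SymbolBound t r ρ (A + B) (fun z => m z + n z) := by
  obtain ⟨M, hM⟩ := hm.bounded
  obtain ⟨N, hN⟩ := hn.bounded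
  refine ⟨hm.measurable.add hn.measurable, ⟨M + N, fun z => norm_add_le_of_le (hM z) (hN z)⟩,
    fun φ ψ hφ hψ x => ?_⟩
  have h1 : bilinMul (fun z => m z + n z) φ ψ x = bilinMul m φ ψ x + bilinMul n φ ψ x := by
    rw [bilinMul, bilinMul, bilinMul, ← integral_add (integrable_bilinMul hm.measurable hM hφ hψ x)
      (integrable_bilinMul hn.measurable hN hφ hψ x)]
    congr with z
    ring
  rw [h1, add_mul]
  exact (enorm_add_le _ _).trans
    (add_le_add (hm.enorm_le φ ψ hφ hψ x) (hn.enorm_le φ ψ hφ hψ x))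

theorem SymbolBound.sum {ι : Type*} (s : Finset ι) {A : ι → ℝ≥0∞}
    {m : ι → EuclideanSpace ℝ (Fin d) × EuclideanSpace ℝ (Fin d) → ℂ}
    (h : ∀ i ∈ s, SymbolBound t r ρ (A i) (m i)) :
    SymbolBound t r ρ (∑ i ∈ s, A i) (fun z => ∑ i ∈ s, m i z) := by
  classical
  induction s using Finset.induction_on with
  | empty => simpa using SymbolBound.zero
  | insert i s hi ih =>
    simp only [Finset.sum_insert hi]
    exact (h i (Finset.mem_insert_self i s)).add
      (ih fun k hk => h k (Finset.mem_insert_of_mem hk))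

theorem SymbolBound.const_mul (h : SymbolBound t r ρ A m) (c : ℂ) :
    SymbolBound t r ρ (‖c‖ₑ * A) (fun z => c * m z) := by
  obtain ⟨M, hM⟩ := h.bounded
  refine ⟨h.measurable.const_mul c, ⟨‖c‖ * M, fun z => ?_⟩, fun φ ψ hφ hψ x => ?_⟩
  · rw [norm_mul]
    gcongr
    exact hM z
  · have h1 : bilinMul (fun z => c * m z) φ ψ x = c * bilinMul m φ ψ x := by
      rw [bilinMul, bilinMul, ← integral_const_mul]
      congr with z
      ring
    rw [h1, enorm_mul, mul_assoc]
    gcongr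
    exact h.enorm_le φ ψ hφ hψ x

theorem measurable_prodCauchy_apply (r : ℝ) :
    Measurable (prodCauchy r : EuclideanSpace ℝ (Fin d) → ℝ≥0∞) := by
  unfold prodCauchy
  fun_prop

theorem measurable_enorm_fourierInv {H : EuclideanSpace ℝ (Fin d) → ℂ} (hH : Integrable H) :
    Measurable fun y => ‖𝓕⁻ H y‖ₑ := by
  simp_rw [Real.fourierInv_eq_fourier_neg]
  exact ((continuous_fourier hH).comp continuous_neg).measurable.enorm

theorem measurable_posConv_mul_posConv {k₁ k₂ F G : EuclideanSpace ℝ (Fin d) → ℝ≥0∞}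
    (hk₁ : Measurable k₁) (hk₂ : Measurable k₂) (hF : Measurable F) (hG : Measurable G) :
    Measurable fun y => posConv k₁ F y * posConv k₂ G y :=
  (measurable_posConv hk₁ hF).mul (measurable_posConv hk₂ hG)

theorem measurable_comp_sub_mul {k F : EuclideanSpace ℝ (Fin d) → ℝ≥0∞} (hk : Measurable k)
    (hF : Measurable F) (x : EuclideanSpace ℝ (Fin d)) : Measurable fun y => k (x - y) * F y :=
  (hk.comp (measurable_const.sub measurable_id)).mul hF

theorem KernelBound.enorm_fourierInv_mul_le {Ψ : EuclideanSpace ℝ (Fin d) → ℂ}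
    (h : KernelBound Ψ A r) {H : EuclideanSpace ℝ (Fin d) → ℂ} (hH : Integrable H)
    (x : EuclideanSpace ℝ (Fin d)) :
    ‖𝓕⁻ (fun v => Ψ v * H v) x‖ₑ ≤ A * posConv (prodCauchy r) (fun y => ‖𝓕⁻ H y‖ₑ) x := by
  obtain ⟨M, hM⟩ := h.bounded
  refine (_root_.enorm_fourierInv_mul_le h.integrable hM h.continuousAt hH x).trans ?_
  rw [posConv, ← lintegral_const_mul _ ?_]
  · refine lintegral_mono fun y => ?_
    rw [← mul_assoc]
    gcongr
    exact h.enorm_le _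
  · exact measurable_comp_sub_mul (measurable_prodCauchy_apply r) (measurable_enorm_fourierInv hH) x

theorem KernelBound.symbolBound {Φ₀ Φ₁ Φ₂ : EuclideanSpace ℝ (Fin d) → ℂ} {A₀ A₁ A₂ : ℝ≥0∞}
    (h₀ : KernelBound Φ₀ A₀ t) (h₁ : KernelBound Φ₁ A₁ r) (h₂ : KernelBound Φ₂ A₂ ρ) :
    SymbolBound t r ρ (A₀ * A₁ * A₂) (fun z => Φ₀ (z.1 + z.2) * (Φ₁ z.1 * Φ₂ z.2)) := by
  obtain ⟨M₀, hM₀⟩ := h₀.bounded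
  obtain ⟨M₁, hM₁⟩ := h₁.bounded
  obtain ⟨M₂, hM₂⟩ := h₂.bounded
  have hm : Measurable fun z : EuclideanSpace ℝ (Fin d) × EuclideanSpace ℝ (Fin d) =>
      Φ₀ (z.1 + z.2) * (Φ₁ z.1 * Φ₂ z.2) := by
    have := h₀.measurable
    have := h₁.measurable
    have := h₂.measurable
    fun_prop
  have hM : ∀ z : EuclideanSpace ℝ (Fin d) × EuclideanSpace ℝ (Fin d),
      ‖Φ₀ (z.1 + z.2) * (Φ₁ z.1 * Φ₂ z.2)‖ ≤ M₀ * (M₁ * M₂) := fun z => by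
    rw [norm_mul, norm_mul]
    have := (norm_nonneg _).trans (hM₀ 0)
    have := (norm_nonneg _).trans (hM₁ 0)
    gcongr
    exacts [hM₀ _, hM₁ _, hM₂ _]
  refine ⟨hm, ⟨_, hM⟩, fun φ ψ hφ hψ x => ?_⟩
  set u : EuclideanSpace ℝ (Fin d) → ℂ := fun ξ => Φ₁ ξ * φ ξ with hu
  set v : EuclideanSpace ℝ (Fin d) → ℂ := fun ξ => Φ₂ ξ * ψ ξ with hv
  have hui : Integrable u := hφ.bdd_mul h₁.measurable.aestronglyMeasurable (ae_of_all _ hM₁)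
  have hvi : Integrable v := hψ.bdd_mul h₂.measurable.aestronglyMeasurable (ae_of_all _ hM₂)
  set H : EuclideanSpace ℝ (Fin d) → ℂ :=
    convolution u v (ContinuousLinearMap.mul ℂ ℂ) volume with hH
  have hHi : Integrable H := hui.integrable_convolution _ hvi
  have hHF : ∀ y, 𝓕⁻ H y = 𝓕⁻ u y * 𝓕⁻ v y := fun y => by
    simp only [Real.fourierInv_eq_fourier_neg]
    exact Real.fourier_mul_convolution_eq hui hvi (-y)
  have key : bilinMul (fun z => Φ₀ (z.1 + z.2) * (Φ₁ z.1 * Φ₂ z.2)) φ ψ x =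
      𝓕⁻ (fun ζ => Φ₀ ζ * H ζ) x := by
    have h3 := integrable_bilinMul hm hM hφ hψ x
    have h4 : ∀ z : EuclideanSpace ℝ (Fin d) × EuclideanSpace ℝ (Fin d),
        Complex.exp ((2 * Real.pi * ⟪z.1 + z.2, x⟫ : ℝ) * Complex.I) *
          (Φ₀ (z.1 + z.2) * (Φ₁ z.1 * Φ₂ z.2) * (φ z.1 * ψ z.2)) =
        Complex.exp ((2 * Real.pi * ⟪z.1 + z.2, x⟫ : ℝ) * Complex.I) * Φ₀ (z.1 + z.2) *
          (u z.1 * v z.2) := fun z => by rw [hu, hv]; ring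
    simp_rw [h4] at h3
    rw [bilinMul, Real.fourierInv_eq']
    simp_rw [h4]
    rw [integral_comp_add_mul (G := fun ζ => Complex.exp ((2 * Real.pi * ⟪ζ, x⟫ : ℝ) * Complex.I) *
      Φ₀ ζ) h3]
    simp_rw [smul_eq_mul, ← mul_assoc]
    rfl
  rw [key]
  refine (h₀.enorm_fourierInv_mul_le hHi x).trans ?_
  rw [mul_assoc, mul_assoc]
  gcongr
  rw [cauchyConv, posConv, posConv, ← mul_assoc, ← lintegral_const_mul'' ]
  · refine lintegral_mono fun y => ?_
    rw [hHF, enorm_mul]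
    calc _ ≤ prodCauchy t (x - y) * ((A₁ * posConv (prodCauchy r) (fun y => ‖𝓕⁻ φ y‖ₑ) y) *
          (A₂ * posConv (prodCauchy ρ) (fun y => ‖𝓕⁻ ψ y‖ₑ) y)) := by
          gcongr
          exacts [h₁.enorm_fourierInv_mul_le hφ y, h₂.enorm_fourierInv_mul_le hψ y]
      _ = _ := by ring
  · exact (measurable_comp_sub_mul (measurable_prodCauchy_apply t)
      (measurable_posConv_mul_posConv (measurable_prodCauchy_apply r)
        (measurable_prodCauchy_apply ρ) (measurable_enorm_fourierInv hφ)
        (measurable_enorm_fourierInv hψ)) x).aemeasurable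

end

theorem sum_bool_halfGaussian (j₀ j₁ j₂ : ℕ) (a t r ρ x y : ℝ) :
    (x + y) ^ j₀ * (x ^ j₁ * y ^ j₂) * Real.exp (-(t * (x + y)) ^ 2 - (r * x) ^ 2 - (ρ * y) ^ 2 +
      a * (|x + y| - |x| - |y|)) =
    ∑ s : Bool × Bool × Bool, halfGaussian s.1 j₀ 0 t (x + y) *
      (halfGaussian s.2.1 j₁ (if s.1 = s.2.1 then 0 else 2 * a) r x *
        halfGaussian s.2.2 j₂ (if s.1 = s.2.2 then 0 else 2 * a) ρ y) := by
  have key : ∀ e₀ e₁ e₂ e : ℝ, e = e₀ + e₁ + e₂ →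
      (x + y) ^ j₀ * (x ^ j₁ * y ^ j₂) * Real.exp e = (x + y) ^ j₀ * Real.exp e₀ *
        (x ^ j₁ * Real.exp e₁ * (y ^ j₂ * Real.exp e₂)) := by
    rintro e₀ e₁ e₂ e rfl
    rw [Real.exp_add, Real.exp_add]
    ring
  simp only [Fintype.sum_prod_type, Fintype.sum_bool, halfGaussian]
  have sgn : ∀ u : ℝ, (0 ≤ u ∧ |u| = u) ∨ (u < 0 ∧ ¬ 0 ≤ u ∧ |u| = -u) := fun u =>
    (le_or_gt 0 u).imp (fun h => ⟨h, abs_of_nonneg h⟩) fun h => ⟨h, h.not_ge, abs_of_neg h⟩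
  rcases sgn (x + y) with ⟨hz, hz'⟩ | ⟨hz₀, hz, hz'⟩ <;>
    rcases sgn x with ⟨hx, hx'⟩ | ⟨hx₀, hx, hx'⟩ <;>
    rcases sgn y with ⟨hy, hy'⟩ | ⟨hy₀, hy, hy'⟩ <;>
    simp only [hz, hx, hy, hz', hx', hy', iff_true, iff_false, reduceCtorEq, not_true_eq_false,
      if_true, if_false, zero_mul, mul_zero, add_zero, zero_add] <;>
    exact key _ _ _ _ (by ring)

/-- The monomial `∏ᵢ xᵢ ^ jᵢ`. -/
noncomputable def powProd {d : ℕ} (j : Fin d → ℕ) (x : EuclideanSpace ℝ (Fin d)) : ℝ :=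
  ∏ i, x i ^ j i

theorem powProd_zero {d : ℕ} (x : EuclideanSpace ℝ (Fin d)) : powProd 0 x = 1 := by
  simp [powProd]

theorem powProd_add_single {d : ℕ} (j : Fin d → ℕ) (i : Fin d) (n : ℕ)
    (x : EuclideanSpace ℝ (Fin d)) : powProd (j + Pi.single i n) x = powProd j x * x i ^ n := by
  simp only [powProd, Pi.add_apply, pow_add, Finset.prod_mul_distrib]
  congr 1
  rw [Finset.prod_eq_single i]
  · simp
  · intro k _ hk
    simp [Pi.single_eq_of_ne hk]
  · simp

theorem sum_add_single {d : ℕ} (j : Fin d → ℕ) (i : Fin d) (n : ℕ) :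
    ∑ k, (j + Pi.single i n : Fin d → ℕ) k = ∑ k, j k + n := by
  simp [Finset.sum_add_distrib]

/-- The Gaussian-regularized symbol of the conjugated product. -/
noncomputable def gaussSymbol {d : ℕ} (a t r ρ : ℝ)
    (z : EuclideanSpace ℝ (Fin d) × EuclideanSpace ℝ (Fin d)) : ℝ :=
  ∏ i, Real.exp (-(t * (z.1 i + z.2 i)) ^ 2 - (r * z.1 i) ^ 2 - (ρ * z.2 i) ^ 2 +
      a * (|z.1 i + z.2 i| - |z.1 i| - |z.2 i|))

theorem exists_symbolBound_powProd {d : ℕ} (j₀ j₁ j₂ : Fin d → ℕ) :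
    ∃ A : ℝ, 0 < A ∧ ∀ a t r ρ : ℝ, 0 ≤ a → 0 < t → 0 < r → 0 < ρ →
      SymbolBound t r ρ
        (ENNReal.ofReal (A * (t⁻¹ ^ (∑ i, j₀ i) * (r⁻¹ ^ (∑ i, j₁ i) * ρ⁻¹ ^ ∑ i, j₂ i))))
        (fun z : EuclideanSpace ℝ (Fin d) × EuclideanSpace ℝ (Fin d) =>
          ((powProd j₀ (z.1 + z.2) * (powProd j₁ z.1 * powProd j₂ z.2) *
            gaussSymbol a t r ρ z : ℝ) : ℂ)) := by
  obtain ⟨A₀, hA₀, h₀⟩ := exists_kernelBound_prod_halfGaussian j₀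
  obtain ⟨A₁, hA₁, h₁⟩ := exists_kernelBound_prod_halfGaussian j₁
  obtain ⟨A₂, hA₂, h₂⟩ := exists_kernelBound_prod_halfGaussian j₂
  refine ⟨Fintype.card (Fin d → Bool × Bool × Bool) * (A₀ * A₁ * A₂), by positivity,
    fun a t r ρ ha ht hr hρ => ?_⟩
  have hif : ∀ b c : Bool, 0 ≤ if b = c then 0 else 2 * a := fun b c => by
    split_ifs <;> positivity
  have h := SymbolBound.sum (Finset.univ : Finset (Fin d → Bool × Bool × Bool))
    fun s _ => (h₀ (fun i => (s i).1) (fun _ => 0) t (fun _ => le_rfl) ht).symbolBound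
      (h₁ (fun i => (s i).2.1) (fun i => if (s i).1 = (s i).2.1 then 0 else 2 * a) r
        (fun i => hif _ _) hr)
      (h₂ (fun i => (s i).2.2) (fun i => if (s i).1 = (s i).2.2 then 0 else 2 * a) ρ
        (fun i => hif _ _) hρ)
  convert h using 1
  · rw [Finset.sum_const, Finset.card_univ, nsmul_eq_mul, ← ENNReal.ofReal_natCast,
      ← ENNReal.ofReal_mul (by positivity), ← ENNReal.ofReal_mul (by positivity),
      ← ENNReal.ofReal_mul (by positivity)]
    congr 1
    ring
  · funext z
    simp only [← Complex.ofReal_prod, ← Complex.ofReal_mul, ← Complex.ofReal_sum]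
    congr 1
    simp only [powProd, gaussSymbol, ← Finset.prod_mul_distrib, PiLp.add_apply,
      sum_bool_halfGaussian]
    rw [Finset.prod_univ_sum, Fintype.piFinset_univ]

theorem norm_pow_two_mul_succ {d : ℕ} (m : ℕ) (x : EuclideanSpace ℝ (Fin d)) :
    ‖x‖ ^ (2 * (m + 1)) = ∑ i, ‖x‖ ^ (2 * m) * x i ^ 2 := by
  rw [← Finset.mul_sum, mul_add, pow_add, mul_one, EuclideanSpace.real_norm_sq_eq]

theorem exists_symbolBound_norm_pow_left {d : ℕ} (m : ℕ) : ∀ j : Fin d → ℕ,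
    ∃ A : ℝ, 0 < A ∧ ∀ a t r ρ : ℝ, 0 ≤ a → 0 < t → 0 < r → 0 < ρ →
      SymbolBound t r ρ (ENNReal.ofReal (A * t⁻¹ ^ (2 * m + ∑ i, j i)))
        (fun z : EuclideanSpace ℝ (Fin d) × EuclideanSpace ℝ (Fin d) =>
          ((‖z.1 + z.2‖ ^ (2 * m) * powProd j (z.1 + z.2) * gaussSymbol a t r ρ z : ℝ) : ℂ)) := by
  induction m with
  | zero =>
    intro j
    obtain ⟨A, hA, h⟩ := exists_symbolBound_powProd j 0 0
    refine ⟨A, hA, fun a t r ρ ha ht hr hρ => ?_⟩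
    simpa [powProd_zero] using h a t r ρ ha ht hr hρ
  | succ m ih =>
    intro j
    choose A hA h using fun i => ih (j + Pi.single i 2)
    refine ⟨1 + ∑ i, A i, add_pos_of_pos_of_nonneg one_pos (Finset.sum_nonneg fun i _ => (hA i).le),
      fun a t r ρ ha ht hr hρ => ?_⟩
    have h1 := SymbolBound.sum Finset.univ fun i _ => h i a t r ρ ha ht hr hρ
    have h2 : ∀ z : EuclideanSpace ℝ (Fin d) × EuclideanSpace ℝ (Fin d),
        ((‖z.1 + z.2‖ ^ (2 * (m + 1)) * powProd j (z.1 + z.2) * gaussSymbol a t r ρ z : ℝ) : ℂ) =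
        ∑ i, ((‖z.1 + z.2‖ ^ (2 * m) * powProd (j + Pi.single i 2) (z.1 + z.2) *
          gaussSymbol a t r ρ z : ℝ) : ℂ) := fun z => by
      rw [← Complex.ofReal_sum, norm_pow_two_mul_succ, Finset.sum_mul, Finset.sum_mul]
      congr 1
      refine Finset.sum_congr rfl fun i _ => ?_
      rw [powProd_add_single]
      ring
    simp_rw [h2]
    refine h1.mono ?_
    rw [← ENNReal.ofReal_sum_of_nonneg fun i _ => mul_nonneg (hA i).le (by positivity)]
    refine ENNReal.ofReal_le_ofReal ?_
    simp_rw [sum_add_single]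
    rw [← Finset.sum_mul, show 2 * m + (∑ k, j k + 2) = 2 * (m + 1) + ∑ k, j k by ring]
    gcongr
    linarith

theorem exists_symbolBound_norm_pow_right {d : ℕ} (m : ℕ) : ∀ j k : Fin d → ℕ,
    ∃ A : ℝ, 0 < A ∧ ∀ a t r ρ : ℝ, 0 ≤ a → 0 < t → 0 < r → 0 < ρ →
      SymbolBound t r ρ (ENNReal.ofReal (A * (r⁻¹ + ρ⁻¹) ^ (2 * m + (∑ i, j i + ∑ i, k i))))
        (fun z : EuclideanSpace ℝ (Fin d) × EuclideanSpace ℝ (Fin d) =>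
          ((‖z.1 + z.2‖ ^ (2 * m) * (powProd j z.1 * powProd k z.2) *
            gaussSymbol a t r ρ z : ℝ) : ℂ)) := by
  induction m with
  | zero =>
    intro j k
    obtain ⟨A, hA, h⟩ := exists_symbolBound_powProd 0 j k
    refine ⟨A, hA, fun a t r ρ ha ht hr hρ => ?_⟩
    have h1 := h a t r ρ ha ht hr hρ
    simp only [powProd_zero, one_mul, Pi.zero_apply, Finset.sum_const_zero, pow_zero] at h1
    simp only [mul_zero, pow_zero, one_mul, zero_add]
    refine h1.mono (ENNReal.ofReal_le_ofReal ?_)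
    rw [pow_add]
    have : 0 ≤ r⁻¹ := by positivity
    have : 0 ≤ ρ⁻¹ := by positivity
    gcongr <;> linarith
  | succ m ih =>
    intro j k
    choose A hA h using fun i => ih (j + Pi.single i 2) k
    choose B hB h' using fun i => ih (j + Pi.single i 1) (k + Pi.single i 1)
    choose C hC h'' using fun i => ih j (k + Pi.single i 2)
    refine ⟨1 + ∑ i, (A i + (2 * B i + C i)), add_pos_of_pos_of_nonneg one_pos
      (Finset.sum_nonneg fun i _ => by have := hA i; have := hB i; have := hC i; positivity),
      fun a t r ρ ha ht hr hρ => ?_⟩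
    have h1 := SymbolBound.sum Finset.univ fun i _ => (h i a t r ρ ha ht hr hρ).add
      (((h' i a t r ρ ha ht hr hρ).const_mul 2).add (h'' i a t r ρ ha ht hr hρ))
    have h2 : ∀ z : EuclideanSpace ℝ (Fin d) × EuclideanSpace ℝ (Fin d),
        ((‖z.1 + z.2‖ ^ (2 * (m + 1)) * (powProd j z.1 * powProd k z.2) *
          gaussSymbol a t r ρ z : ℝ) : ℂ) =
        ∑ i, (((‖z.1 + z.2‖ ^ (2 * m) * (powProd (j + Pi.single i 2) z.1 * powProd k z.2) *
          gaussSymbol a t r ρ z : ℝ) : ℂ) + (2 * ((‖z.1 + z.2‖ ^ (2 * m) *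
          (powProd (j + Pi.single i 1) z.1 * powProd (k + Pi.single i 1) z.2) *
          gaussSymbol a t r ρ z : ℝ) : ℂ) + ((‖z.1 + z.2‖ ^ (2 * m) *
          (powProd j z.1 * powProd (k + Pi.single i 2) z.2) *
          gaussSymbol a t r ρ z : ℝ) : ℂ))) := fun z => by
      rw [norm_pow_two_mul_succ, Finset.sum_mul, Finset.sum_mul, Complex.ofReal_sum]
      refine Finset.sum_congr rfl fun i _ => ?_
      simp only [powProd_add_single, PiLp.add_apply]
      push_cast
      ring
    simp_rw [h2]
    refine h1.mono ?_
    have h3 : ‖(2 : ℂ)‖ₑ = ENNReal.ofReal 2 := by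
      rw [← ofReal_norm]
      norm_num
    simp_rw [sum_add_single, h3]
    have e1 : 2 * m + (∑ i, j i + 2 + ∑ i, k i) = 2 * (m + 1) + (∑ i, j i + ∑ i, k i) := by ring
    have e2 : 2 * m + (∑ i, j i + 1 + (∑ i, k i + 1)) = 2 * (m + 1) + (∑ i, j i + ∑ i, k i) := by
      ring
    have e3 : 2 * m + (∑ i, j i + (∑ i, k i + 2)) = 2 * (m + 1) + (∑ i, j i + ∑ i, k i) := by ring
    rw [e1, e2, e3]
    have hX : 0 ≤ (r⁻¹ + ρ⁻¹) ^ (2 * (m + 1) + (∑ i, j i + ∑ i, k i)) := by positivity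
    set X := (r⁻¹ + ρ⁻¹) ^ (2 * (m + 1) + (∑ i, j i + ∑ i, k i))
    have h4 : ∀ i, ENNReal.ofReal (A i * X) + (ENNReal.ofReal 2 * ENNReal.ofReal (B i * X) +
        ENNReal.ofReal (C i * X)) = ENNReal.ofReal ((A i + (2 * B i + C i)) * X) := fun i => by
      have := hA i
      have := hB i
      have := hC i
      rw [← ENNReal.ofReal_mul (by positivity), ← ENNReal.ofReal_add (by positivity)
        (by positivity), ← ENNReal.ofReal_add (by positivity) (by positivity)]
      congr 1
      ring
    simp_rw [h4]
    rw [← ENNReal.ofReal_sum_of_nonneg fun i _ => by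
      have := hA i; have := hB i; have := hC i; positivity]
    refine ENNReal.ofReal_le_ofReal ?_
    rw [← Finset.sum_mul]
    gcongr
    linarith

theorem mul_add_rpow_le {s t u v : ℝ} (hs : 0 < s) (ht : 0 < t) (hu : 0 < u) (hv : 0 < v) :
    (t * (u + v)) ^ s ≤ 2 ^ s * (t ^ s * (u ^ s + v ^ s)) := by
  have h : u + v ≤ 2 * max u v := by linarith [le_max_left u v, le_max_right u v]
  have h2 : (max u v) ^ s ≤ u ^ s + v ^ s := by
    have := Real.rpow_nonneg hu.le s
    have := Real.rpow_nonneg hv.le s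
    rcases max_choice u v with h | h <;> rw [h] <;> linarith
  calc (t * (u + v)) ^ s ≤ (t * (2 * max u v)) ^ s := by gcongr
    _ = 2 ^ s * (t ^ s * (max u v) ^ s) := by
        rw [Real.mul_rpow ht.le (by positivity), Real.mul_rpow two_pos.le (by positivity)]
        ring
    _ ≤ _ := by gcongr

theorem exists_symbolBound_gaussSymbol {d : ℕ} {m : ℕ} {s : ℝ} (hs : 0 < s) (hsm : s ≤ 2 * m) :
    ∃ A : ℝ, 0 < A ∧ ∀ a t r ρ : ℝ, 0 ≤ a → 0 < t → 0 < r → 0 < ρ →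
      SymbolBound t r ρ (ENNReal.ofReal (A * (t ^ (s - 2 * m) * (r ^ (-s) + ρ ^ (-s)))))
        (fun z : EuclideanSpace ℝ (Fin d) × EuclideanSpace ℝ (Fin d) =>
          ((‖z.1 + z.2‖ ^ (2 * m) * gaussSymbol a t r ρ z : ℝ) : ℂ)) := by
  obtain ⟨A, hA, h⟩ := exists_symbolBound_norm_pow_left (d := d) m 0
  obtain ⟨B, hB, h'⟩ := exists_symbolBound_norm_pow_right (d := d) m 0 0
  refine ⟨(A + B) * 2 ^ s, by positivity, fun a t r ρ ha ht hr hρ => ?_⟩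
  have h1 := h a t r ρ ha ht hr hρ
  have h2 := h' a t r ρ ha ht hr hρ
  simp only [powProd_zero, mul_one, Pi.zero_apply, Finset.sum_const_zero, add_zero] at h1 h2
  set X := r⁻¹ + ρ⁻¹ with hX
  have hX0 : 0 < X := by positivity
  have htX : 0 < t * X := by positivity
  have key : t⁻¹ ^ (2 * m) * (t * X) ^ s ≤
      2 ^ s * (t ^ (s - 2 * m) * (r ^ (-s) + ρ ^ (-s))) := by
    have e1 : t⁻¹ ^ (2 * m) = t ^ (-(2 * m : ℝ)) := by
      rw [Real.rpow_neg ht.le, inv_pow]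
      norm_cast
    calc _ ≤ t⁻¹ ^ (2 * m) * (2 ^ s * (t ^ s * (r⁻¹ ^ s + ρ⁻¹ ^ s))) := by
          gcongr
          exact mul_add_rpow_le hs ht (by positivity) (by positivity)
      _ = _ := by
          rw [e1, sub_eq_neg_add, Real.rpow_add ht, Real.inv_rpow hr.le, Real.inv_rpow hρ.le,
            Real.rpow_neg hr.le, Real.rpow_neg hρ.le]
          ring
  have hY : 0 ≤ 2 ^ s * (t ^ (s - 2 * m) * (r ^ (-s) + ρ ^ (-s))) := by positivity
  rcases le_total 1 (t * X) with hc | hc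
  · refine h1.mono (ENNReal.ofReal_le_ofReal ?_)
    have : t⁻¹ ^ (2 * m) ≤ t⁻¹ ^ (2 * m) * (t * X) ^ s :=
      le_mul_of_one_le_right (by positivity) (Real.one_le_rpow hc hs.le)
    rw [mul_assoc]
    exact mul_le_mul (by linarith) (this.trans key) (by positivity) (by positivity)
  · refine h2.mono (ENNReal.ofReal_le_ofReal ?_)
    have : X ^ (2 * m) ≤ t⁻¹ ^ (2 * m) * (t * X) ^ s := by
      calc X ^ (2 * m) = t⁻¹ ^ (2 * m) * (t * X) ^ (2 * m) := by
            rw [← mul_pow, inv_mul_cancel_left₀ ht.ne']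
        _ = t⁻¹ ^ (2 * m) * (t * X) ^ (2 * m : ℝ) := by norm_cast
        _ ≤ _ := by
            gcongr ?_ * ?_
            exact Real.rpow_le_rpow_of_exponent_ge htX hc hsm
    rw [mul_assoc]
    exact mul_le_mul (by linarith) (this.trans key) (by positivity) (by positivity)

theorem lintegral_lintegral_lintegral_mul {α β : Type*} [MeasurableSpace α] [MeasurableSpace β]
    (μ : Measure α) (ν : Measure β) [SFinite μ] [SFinite ν] {k : β → ℝ≥0∞} {P Q : α × β → ℝ≥0∞}
    (hk : Measurable k) (hP : Measurable P) (hQ : Measurable Q) :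
    ∫⁻ r, ∫⁻ ρ, ∫⁻ y, k y * (P (r, y) * Q (ρ, y)) ∂ν ∂μ ∂μ =
      ∫⁻ y, k y * ((∫⁻ r, P (r, y) ∂μ) * ∫⁻ ρ, Q (ρ, y) ∂μ) ∂ν := by
  have hQ' : Measurable fun y => ∫⁻ ρ, Q (ρ, y) ∂μ := hQ.lintegral_prod_left'
  calc _ = ∫⁻ r, ∫⁻ y, ∫⁻ ρ, k y * (P (r, y) * Q (ρ, y)) ∂μ ∂ν ∂μ := by
        refine lintegral_congr fun r => lintegral_lintegral_swap ?_
        exact Measurable.aemeasurable (by fun_prop)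
    _ = ∫⁻ r, ∫⁻ y, k y * (P (r, y) * ∫⁻ ρ, Q (ρ, y) ∂μ) ∂ν ∂μ := by
        refine lintegral_congr fun r => lintegral_congr fun y => ?_
        rw [lintegral_const_mul _ (by fun_prop), lintegral_const_mul _ (by fun_prop)]
    _ = ∫⁻ y, ∫⁻ r, k y * (P (r, y) * ∫⁻ ρ, Q (ρ, y) ∂μ) ∂μ ∂ν := by
        refine lintegral_lintegral_swap ?_
        exact Measurable.aemeasurable (by fun_prop)
    _ = _ := by
        refine lintegral_congr fun y => ?_
        rw [lintegral_const_mul _ (by fun_prop), lintegral_mul_const _ (by fun_prop)]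

section Scales

variable {d : ℕ}

theorem measurable_posConv_prodCauchy {F : EuclideanSpace ℝ (Fin d) → ℝ≥0∞} (hF : Measurable F) :
    Measurable fun z : ℝ × EuclideanSpace ℝ (Fin d) => posConv (prodCauchy z.1) F z.2 := by
  have h : Measurable fun w : (ℝ × EuclideanSpace ℝ (Fin d)) × EuclideanSpace ℝ (Fin d) =>
      prodCauchy w.1.1 (w.1.2 - w.2) * F w.2 := by
    unfold prodCauchy
    fun_prop
  exact h.lintegral_prod_right'

theorem measurable_posConv_prodCauchy_left {F : EuclideanSpace ℝ (Fin d) → ℝ≥0∞}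
    (hF : Measurable F) (y : EuclideanSpace ℝ (Fin d)) :
    Measurable fun r : ℝ => posConv (prodCauchy r) F y := by
  have h : Measurable fun w : ℝ × EuclideanSpace ℝ (Fin d) =>
      prodCauchy w.1 (y - w.2) * F w.2 := by
    unfold prodCauchy
    fun_prop
  exact h.lintegral_prod_right'

theorem lintegral_rpow_mul_posConv_prodCauchy_le {δ : ℝ} (hδ : 0 < δ) (hδ1 : δ < 1)
    (hd : 1 ≤ d) : ∃ C : ℝ, 0 < C ∧ ∀ F : EuclideanSpace ℝ (Fin d) → ℝ≥0∞, Measurable F → ∀ x,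
      ∫⁻ r in Set.Ioi 0, ENNReal.ofReal (r ^ (d * δ - 1)) * posConv (prodCauchy r) F x ≤
        ENNReal.ofReal C * posConv (prodRiesz δ) F x := by
  obtain ⟨C, hC, h⟩ := lintegral_rpow_mul_prodCauchy_le hδ hδ1 hd
  refine ⟨C, hC, fun F hF x => ?_⟩
  have hm : Measurable fun w : ℝ × EuclideanSpace ℝ (Fin d) =>
      ENNReal.ofReal (w.1 ^ (d * δ - 1)) * (prodCauchy w.1 (x - w.2) * F w.2) := by
    unfold prodCauchy
    fun_prop
  calc _ = ∫⁻ r in Set.Ioi 0, ∫⁻ y, ENNReal.ofReal (r ^ (d * δ - 1)) *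
        (prodCauchy r (x - y) * F y) := by
        refine lintegral_congr fun r => ?_
        rw [posConv, lintegral_const_mul _ (measurable_comp_sub_mul
          (measurable_prodCauchy_apply r) hF x)]
    _ = ∫⁻ y, ∫⁻ r in Set.Ioi 0, ENNReal.ofReal (r ^ (d * δ - 1)) *
        (prodCauchy r (x - y) * F y) := lintegral_lintegral_swap hm.aemeasurable
    _ ≤ ∫⁻ y, ENNReal.ofReal C * (prodRiesz δ (x - y) * F y) := by
        refine lintegral_mono fun y => ?_
        simp_rw [← mul_assoc]
        rw [lintegral_mul_const]
        · gcongr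
          exact h _
        · unfold prodCauchy
          fun_prop
    _ = _ := by
        rw [lintegral_const_mul _ (measurable_comp_sub_mul (measurable_prodRiesz δ) hF x), posConv]

theorem lintegral_rpow_mul_cauchyConv_le {δ₀ δ₁ δ₂ : ℝ} (hδ₀ : 0 < δ₀) (hδ₀' : δ₀ < 1)
    (hδ₁ : 0 < δ₁) (hδ₁' : δ₁ < 1) (hδ₂ : 0 < δ₂) (hδ₂' : δ₂ < 1) (hd : 1 ≤ d) :
    ∃ C : ℝ, 0 < C ∧ ∀ F G : EuclideanSpace ℝ (Fin d) → ℝ≥0∞, Measurable F → Measurable G → ∀ x,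
      ∫⁻ r in Set.Ioi 0, ∫⁻ ρ in Set.Ioi 0, ∫⁻ t in Set.Ioi 0,
        ENNReal.ofReal (r ^ (d * δ₁ - 1)) * (ENNReal.ofReal (ρ ^ (d * δ₂ - 1)) *
          (ENNReal.ofReal (t ^ (d * δ₀ - 1)) * cauchyConv t r ρ F G x)) ≤
        ENNReal.ofReal C * posConv (prodRiesz δ₀)
          (fun y => posConv (prodRiesz δ₁) F y * posConv (prodRiesz δ₂) G y) x := by
  obtain ⟨C₀, hC₀, h₀⟩ := lintegral_rpow_mul_posConv_prodCauchy_le hδ₀ hδ₀' hd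
  obtain ⟨C₁, hC₁, h₁⟩ := lintegral_rpow_mul_posConv_prodCauchy_le hδ₁ hδ₁' hd
  obtain ⟨C₂, hC₂, h₂⟩ := lintegral_rpow_mul_posConv_prodCauchy_le hδ₂ hδ₂' hd
  refine ⟨C₀ * (C₁ * C₂), by positivity, fun F G hF hG x => ?_⟩
  have hw : ∀ c : ℝ, Measurable fun r : ℝ => ENNReal.ofReal (r ^ c) := fun c => by fun_prop
  set P : ℝ × EuclideanSpace ℝ (Fin d) → ℝ≥0∞ := fun z =>
    ENNReal.ofReal (z.1 ^ (d * δ₁ - 1)) * posConv (prodCauchy z.1) F z.2 with hP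
  set Q : ℝ × EuclideanSpace ℝ (Fin d) → ℝ≥0∞ := fun z =>
    ENNReal.ofReal (z.1 ^ (d * δ₂ - 1)) * posConv (prodCauchy z.1) G z.2 with hQ
  have hPm : Measurable P := ((hw _).comp measurable_fst).mul (measurable_posConv_prodCauchy hF)
  have hQm : Measurable Q := ((hw _).comp measurable_fst).mul (measurable_posConv_prodCauchy hG)
  have hK : Measurable fun y => prodRiesz δ₀ (x - y) :=
    (measurable_prodRiesz δ₀).comp (measurable_const.sub measurable_id)
  have hPQ : ∀ r ρ : ℝ, Measurable fun y => prodRiesz δ₀ (x - y) * (P (r, y) * Q (ρ, y)) :=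
    fun r ρ => by fun_prop
  calc _ ≤ ∫⁻ r in Set.Ioi 0, ∫⁻ ρ in Set.Ioi 0, ENNReal.ofReal C₀ *
        ∫⁻ y, prodRiesz δ₀ (x - y) * (P (r, y) * Q (ρ, y)) := by
        refine lintegral_mono fun r => lintegral_mono fun ρ => ?_
        have hH := measurable_posConv_mul_posConv (measurable_prodCauchy_apply r)
          (measurable_prodCauchy_apply ρ) hF hG
        have hmt : Measurable fun t : ℝ => ENNReal.ofReal (t ^ (d * δ₀ - 1)) *
            cauchyConv t r ρ F G x := (hw _).mul (measurable_posConv_prodCauchy_left hH x)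
        dsimp only
        rw [lintegral_const_mul _ (hmt.const_mul _), lintegral_const_mul _ hmt]
        calc _ ≤ ENNReal.ofReal (r ^ (d * δ₁ - 1)) * (ENNReal.ofReal (ρ ^ (d * δ₂ - 1)) *
              (ENNReal.ofReal C₀ * ∫⁻ y, prodRiesz δ₀ (x - y) *
                (posConv (prodCauchy r) F y * posConv (prodCauchy ρ) G y))) := by
              gcongr
              exact h₀ _ hH x
          _ = _ := by
              rw [mul_left_comm (ENNReal.ofReal (ρ ^ _)), mul_left_comm (ENNReal.ofReal (r ^ _)),
                ← mul_assoc (ENNReal.ofReal (r ^ _)), ← lintegral_const_mul _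
                (measurable_comp_sub_mul (measurable_prodRiesz δ₀) hH x)]
              congr 1
              refine lintegral_congr fun y => ?_
              rw [hP, hQ]
              ring
    _ = ENNReal.ofReal C₀ * ∫⁻ r in Set.Ioi 0, ∫⁻ ρ in Set.Ioi 0,
          ∫⁻ y, prodRiesz δ₀ (x - y) * (P (r, y) * Q (ρ, y)) := by
        have h1 : Measurable fun z : (ℝ × ℝ) × EuclideanSpace ℝ (Fin d) =>
          prodRiesz δ₀ (x - z.2) * (P (z.1.1, z.2) * Q (z.1.2, z.2)) := by
          have hK2 : Measurable fun z : (ℝ × ℝ) × EuclideanSpace ℝ (Fin d) =>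
            prodRiesz δ₀ (x - z.2) := hK.comp measurable_snd
          have hPQ2 : Measurable fun z : (ℝ × ℝ) × EuclideanSpace ℝ (Fin d) =>
            P (z.1.1, z.2) * Q (z.1.2, z.2) := by fun_prop
          exact hK2.mul hPQ2
        have h2 : Measurable fun z : ℝ × ℝ =>
          ∫⁻ y, prodRiesz δ₀ (x - y) * (P (z.1, y) * Q (z.2, y)) := h1.lintegral_prod_right'
        have h3 : Measurable fun r : ℝ => ∫⁻ ρ in Set.Ioi (0 : ℝ),
          ∫⁻ y, prodRiesz δ₀ (x - y) * (P (r, y) * Q (ρ, y)) := h2.lintegral_prod_right'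
        rw [← lintegral_const_mul _ h3]
        refine lintegral_congr fun r => ?_
        have h4 : Measurable fun ρ : ℝ => ∫⁻ y, prodRiesz δ₀ (x - y) * (P (r, y) * Q (ρ, y)) := by
          have h5 : Measurable fun ρ : ℝ => (r, ρ) := by fun_prop
          have h6 := h2.comp h5
          exact h6
        rw [← lintegral_const_mul _ h4]
    _ ≤ ENNReal.ofReal C₀ * ∫⁻ y, prodRiesz δ₀ (x - y) *
          ((ENNReal.ofReal C₁ * posConv (prodRiesz δ₁) F y) *
            (ENNReal.ofReal C₂ * posConv (prodRiesz δ₂) G y)) := by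
        rw [lintegral_lintegral_lintegral_mul _ _ hK hPm hQm]
        gcongr with y
        exacts [h₁ F hF y, h₂ G hG y]
    _ = _ := by
        rw [posConv, ENNReal.ofReal_mul hC₀.le, ENNReal.ofReal_mul hC₁.le, mul_assoc,
          ← lintegral_const_mul _ (measurable_comp_sub_mul (measurable_prodRiesz δ₀)
          (measurable_posConv_mul_posConv (measurable_prodRiesz δ₁)
          (measurable_prodRiesz δ₂) hF hG) x)]
        congr 1
        refine lintegral_congr fun y => ?_
        ring

end Scales

theorem fourier_mul_eq_integral {d : ℕ} (f g : SchwartzMap (EuclideanSpace ℝ (Fin d)) ℂ)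
    (ζ : EuclideanSpace ℝ (Fin d)) :
    𝓕 (fun x => f x * g x) ζ = ∫ ξ, 𝓕 (⇑f) ξ * 𝓕 (⇑g) (ζ - ξ) := by
  set f' : SchwartzMap (EuclideanSpace ℝ (Fin d)) ℂ := 𝓕 f with hf'
  set g' : SchwartzMap (EuclideanSpace ℝ (Fin d)) ℂ := 𝓕 g with hg'
  set H := SchwartzMap.convolution (ContinuousLinearMap.mul ℂ ℂ) f' g' with hH
  have h1 : ∀ x, H x = (convolution (⇑f') (⇑g') (ContinuousLinearMap.mul ℂ ℂ) volume) x :=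
    SchwartzMap.convolution_apply _ _ _
  have h2 : (fun x => f x * g x) = 𝓕⁻ (⇑H) := by
    funext x
    rw [show (⇑H) = convolution (⇑f') (⇑g') (ContinuousLinearMap.mul ℂ ℂ) volume from
      funext h1, Real.fourierInv_eq_fourier_neg, Real.fourier_mul_convolution_eq
      f'.integrable g'.integrable, ← Real.fourierInv_eq_fourier_neg,
      ← Real.fourierInv_eq_fourier_neg, ← SchwartzMap.fourierInv_coe, ← SchwartzMap.fourierInv_coe]
    simp [hf', hg']
  rw [h2, ← SchwartzMap.fourierInv_coe, ← SchwartzMap.fourier_coe,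
    FourierTransform.fourier_fourierInv_eq, h1]
  simp only [← SchwartzMap.fourier_coe]
  rfl

theorem integrableOn_rpow_mul_exp_sq {σ X : ℝ} (hσ : 0 < σ) (hX : 0 < X) :
    IntegrableOn (fun r : ℝ => r ^ (σ - 1) * Real.exp (-(r * X) ^ 2)) (Set.Ioi 0) := by
  refine (integrableOn_rpow_mul_exp_neg_mul_sq (pow_pos hX 2)
    (by linarith : -1 < σ - 1)).congr_fun (fun r _ => ?_) measurableSet_Ioi
  dsimp only
  ring_nf

theorem integral_rpow_mul_exp_sq {σ X : ℝ} (hσ : 0 < σ) (hX : 0 < X) :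
    ∫ r in Set.Ioi (0 : ℝ), r ^ (σ - 1) * Real.exp (-(r * X) ^ 2) =
      Real.Gamma (σ / 2) / 2 * X ^ (-σ) := by
  have h := integral_rpow_mul_exp_neg_mul_rpow two_pos (by linarith : -1 < σ - 1) (pow_pos hX 2)
  have h1 : (X ^ 2) ^ (-(σ - 1 + 1) / 2) = X ^ (-σ) := by
    rw [← Real.rpow_natCast X 2, ← Real.rpow_mul hX.le]
    congr 1
    push_cast
    ring
  rw [h1, show (σ - 1 + 1) / 2 = σ / 2 by ring] at h
  rw [show Real.Gamma (σ / 2) / 2 * X ^ (-σ) = X ^ (-σ) * (1 / 2) * Real.Gamma (σ / 2) by ring, ← h]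
  refine setIntegral_congr_fun measurableSet_Ioi fun r _ => ?_
  rw [Real.rpow_two]
  ring_nf

theorem gaussSymbol_eq {d : ℕ} (a t r ρ : ℝ)
    (z : EuclideanSpace ℝ (Fin d) × EuclideanSpace ℝ (Fin d)) :
    gaussSymbol a t r ρ z = Real.exp (a * (∑ i, |z.1 i + z.2 i| - ∑ i, |z.1 i| - ∑ i, |z.2 i|)) *
      (Real.exp (-(r * ‖z.1‖) ^ 2) * (Real.exp (-(ρ * ‖z.2‖) ^ 2) *
        Real.exp (-(t * ‖z.1 + z.2‖) ^ 2))) := by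
  rw [gaussSymbol, ← Real.exp_sum, ← Real.exp_add, ← Real.exp_add, ← Real.exp_add]
  congr 1
  simp only [mul_pow, EuclideanSpace.real_norm_sq_eq, PiLp.add_apply, Finset.sum_add_distrib,
    Finset.sum_sub_distrib, Finset.sum_neg_distrib, ← Finset.mul_sum]
  ring

/-- The weight of the superposition of Gaussians that produces homogeneous symbols. -/
noncomputable def scaleWeight (σ₁ σ₂ σ₃ : ℝ) (w : ℝ × ℝ × ℝ) : ℝ :=
  w.1 ^ (σ₁ - 1) * (w.2.1 ^ (σ₂ - 1) * w.2.2 ^ (σ₃ - 1))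

theorem integrable_scaleWeight_mul_gaussSymbol {d : ℕ} (a : ℝ) {σ₁ σ₂ σ₃ : ℝ} (h₁ : 0 < σ₁)
    (h₂ : 0 < σ₂) (h₃ : 0 < σ₃) {z : EuclideanSpace ℝ (Fin d) × EuclideanSpace ℝ (Fin d)}
    (hz₁ : z.1 ≠ 0) (hz₂ : z.2 ≠ 0) (hz : z.1 + z.2 ≠ 0) :
    Integrable (fun w : ℝ × ℝ × ℝ => scaleWeight σ₁ σ₂ σ₃ w * gaussSymbol a w.2.2 w.1 w.2.1 z)
      ((volume.restrict (Set.Ioi 0)).prod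
        ((volume.restrict (Set.Ioi 0)).prod (volume.restrict (Set.Ioi 0)))) := by
  have i₁ := integrableOn_rpow_mul_exp_sq h₁ (norm_pos_iff.2 hz₁)
  have i₂ := integrableOn_rpow_mul_exp_sq h₂ (norm_pos_iff.2 hz₂)
  have i₃ := integrableOn_rpow_mul_exp_sq h₃ (norm_pos_iff.2 hz)
  refine ((i₁.mul_prod (i₂.mul_prod i₃)).const_mul (Real.exp
    (a * (∑ i, |z.1 i + z.2 i| - ∑ i, |z.1 i| - ∑ i, |z.2 i|)))).congr (ae_of_all _ fun w => ?_)
  dsimp only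
  rw [gaussSymbol_eq, scaleWeight]
  ring

theorem integral_scaleWeight_mul_gaussSymbol {d : ℕ} (a : ℝ) {σ₁ σ₂ σ₃ : ℝ} (h₁ : 0 < σ₁)
    (h₂ : 0 < σ₂) (h₃ : 0 < σ₃) {z : EuclideanSpace ℝ (Fin d) × EuclideanSpace ℝ (Fin d)}
    (hz₁ : z.1 ≠ 0) (hz₂ : z.2 ≠ 0) (hz : z.1 + z.2 ≠ 0) :
    ∫ w : ℝ × ℝ × ℝ, scaleWeight σ₁ σ₂ σ₃ w * gaussSymbol a w.2.2 w.1 w.2.1 z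
      ∂((volume.restrict (Set.Ioi 0)).prod
        ((volume.restrict (Set.Ioi 0)).prod (volume.restrict (Set.Ioi 0)))) =
      Real.Gamma (σ₁ / 2) / 2 * (Real.Gamma (σ₂ / 2) / 2 * (Real.Gamma (σ₃ / 2) / 2)) *
        (Real.exp (a * (∑ i, |z.1 i + z.2 i| - ∑ i, |z.1 i| - ∑ i, |z.2 i|)) *
        (‖z.1‖ ^ (-σ₁) * (‖z.2‖ ^ (-σ₂) * ‖z.1 + z.2‖ ^ (-σ₃)))) := by
  have e₁ := integral_rpow_mul_exp_sq h₁ (norm_pos_iff.2 hz₁)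
  have e₂ := integral_rpow_mul_exp_sq h₂ (norm_pos_iff.2 hz₂)
  have e₃ := integral_rpow_mul_exp_sq h₃ (norm_pos_iff.2 hz)
  have h : ∀ w : ℝ × ℝ × ℝ, scaleWeight σ₁ σ₂ σ₃ w * gaussSymbol a w.2.2 w.1 w.2.1 z =
      Real.exp (a * (∑ i, |z.1 i + z.2 i| - ∑ i, |z.1 i| - ∑ i, |z.2 i|)) *
      ((w.1 ^ (σ₁ - 1) * Real.exp (-(w.1 * ‖z.1‖) ^ 2)) *
        (fun u : ℝ × ℝ => (u.1 ^ (σ₂ - 1) * Real.exp (-(u.1 * ‖z.2‖) ^ 2)) *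
        (u.2 ^ (σ₃ - 1) * Real.exp (-(u.2 * ‖z.1 + z.2‖) ^ 2))) w.2) := fun w => by
    rw [gaussSymbol_eq, scaleWeight]
    ring
  rw [funext h, integral_const_mul,
    integral_prod_mul (fun r : ℝ => r ^ (σ₁ - 1) * Real.exp (-(r * ‖z.1‖) ^ 2))
      (fun u : ℝ × ℝ => (u.1 ^ (σ₂ - 1) * Real.exp (-(u.1 * ‖z.2‖) ^ 2)) *
        (u.2 ^ (σ₃ - 1) * Real.exp (-(u.2 * ‖z.1 + z.2‖) ^ 2))),
    integral_prod_mul (fun r : ℝ => r ^ (σ₂ - 1) * Real.exp (-(r * ‖z.2‖) ^ 2))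
      (fun r : ℝ => r ^ (σ₃ - 1) * Real.exp (-(r * ‖z.1 + z.2‖) ^ 2)), e₁, e₂, e₃]
  ring

/-- The symbol of the operator `gev d a β`. -/
noncomputable def gevSymbol {d : ℕ} (a β : ℝ) (ξ : EuclideanSpace ℝ (Fin d)) : ℝ :=
  Real.exp (a * ∑ i, |ξ i|) * ‖ξ‖ ^ β

section

variable {d : ℕ} {a α β γ : ℝ}

theorem continuous_gevSymbol (hα : 0 < α) :
    Continuous (gevSymbol a α : EuclideanSpace ℝ (Fin d) → ℝ) := by
  unfold gevSymbol
  exact Continuous.mul (by fun_prop) (continuous_norm.rpow_const fun _ => Or.inr hα.le)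

theorem continuous_fourier_schwartz (f : SchwartzMap (EuclideanSpace ℝ (Fin d)) ℂ) :
    Continuous (𝓕 ⇑f) := by
  rw [← SchwartzMap.fourier_coe]
  exact SchwartzMap.continuous _

theorem integrable_gevSymbol_mul (hα : 0 < α) (f : SchwartzMap (EuclideanSpace ℝ (Fin d)) ℂ)
    (hf : HasCompactSupport (𝓕 ⇑f)) :
    Integrable fun ξ => (gevSymbol a α ξ : ℂ) * 𝓕 (⇑f) ξ :=
  ((Complex.continuous_ofReal.comp (continuous_gevSymbol hα)).mul
    (continuous_fourier_schwartz f)).integrable_of_hasCompactSupport hf.mul_left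

theorem gev_eq_fourierInv (h : EuclideanSpace ℝ (Fin d) → ℂ) :
    gev d a α h = 𝓕⁻ fun ξ => (gevSymbol a α ξ : ℂ) * 𝓕 h ξ := by
  funext x
  rw [gev, Real.fourierInv_eq']
  refine integral_congr_ae (ae_of_all _ fun ξ => ?_)
  simp only [real_inner_comm x ξ, smul_eq_mul, gevSymbol, mul_assoc]

theorem integrable_gev_mul (hγ : 0 < γ) (f g : SchwartzMap (EuclideanSpace ℝ (Fin d)) ℂ)
    (hf : HasCompactSupport (𝓕 ⇑f)) (hg : HasCompactSupport (𝓕 ⇑g))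
    (x : EuclideanSpace ℝ (Fin d)) :
    Integrable fun z : EuclideanSpace ℝ (Fin d) × EuclideanSpace ℝ (Fin d) =>
      (Complex.exp ((2 * Real.pi * ⟪z.1 + z.2, x⟫ : ℝ) * Complex.I) *
        (gevSymbol a γ (z.1 + z.2) : ℂ)) * (𝓕 (⇑f) z.1 * 𝓕 (⇑g) z.2) := by
  have hc := continuous_gevSymbol (d := d) (a := a) hγ
  have hf' := continuous_fourier_schwartz f
  have hg' := continuous_fourier_schwartz g
  refine Continuous.integrable_of_hasCompactSupport (by fun_prop) ?_
  refine HasCompactSupport.intro (hf.isCompact.prod hg.isCompact) fun z hz => ?_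
  rw [Set.mem_prod, not_and_or] at hz
  rcases hz with h | h
  · rw [image_eq_zero_of_notMem_tsupport h]; ring
  · rw [image_eq_zero_of_notMem_tsupport h]; ring

theorem gev_mul_eq_integral (hγ : 0 < γ) (f g : SchwartzMap (EuclideanSpace ℝ (Fin d)) ℂ)
    (hf : HasCompactSupport (𝓕 ⇑f)) (hg : HasCompactSupport (𝓕 ⇑g))
    (x : EuclideanSpace ℝ (Fin d)) :
    gev d a γ (fun y => f y * g y) x =
      ∫ z : EuclideanSpace ℝ (Fin d) × EuclideanSpace ℝ (Fin d),
      (Complex.exp ((2 * Real.pi * ⟪z.1 + z.2, x⟫ : ℝ) * Complex.I) *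
        (gevSymbol a γ (z.1 + z.2) : ℂ)) * (𝓕 (⇑f) z.1 * 𝓕 (⇑g) z.2) := by
  rw [integral_comp_add_mul (G := fun ζ : EuclideanSpace ℝ (Fin d) =>
    Complex.exp ((2 * Real.pi * ⟪ζ, x⟫ : ℝ) * Complex.I) * (gevSymbol a γ ζ : ℂ))
    (integrable_gev_mul hγ f g hf hg x), gev]
  refine integral_congr_ae (ae_of_all _ fun ζ => ?_)
  simp only [fourier_mul_eq_integral, real_inner_comm x ζ, gevSymbol]

theorem ae_ne_zero_and_ne_zero_and_add_ne_zero (hd : 1 ≤ d) :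
    ∀ᵐ z : EuclideanSpace ℝ (Fin d) × EuclideanSpace ℝ (Fin d),
      z.1 ≠ 0 ∧ z.2 ≠ 0 ∧ z.1 + z.2 ≠ 0 := by
  have : Nonempty (Fin d) := ⟨⟨0, hd⟩⟩
  have : Nontrivial (EuclideanSpace ℝ (Fin d)) := inferInstance
  have hm : MeasurableSet {z : EuclideanSpace ℝ (Fin d) × EuclideanSpace ℝ (Fin d) |
      z.1 ≠ 0 ∧ z.2 ≠ 0 ∧ z.1 + z.2 ≠ 0} :=
    ((isOpen_ne_fun continuous_fst continuous_const).inter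
      ((isOpen_ne_fun continuous_snd continuous_const).inter
        (isOpen_ne_fun (continuous_fst.add continuous_snd) continuous_const))).measurableSet
  refine (Measure.ae_prod_iff_ae_ae hm).2 ?_
  filter_upwards [Measure.ae_ne volume 0] with ξ hξ
  filter_upwards [Measure.ae_ne volume 0, Measure.ae_ne volume (-ξ)] with η hη hη'
  exact ⟨hξ, hη, fun h => hη' (eq_neg_of_add_eq_zero_right h)⟩

end

/-- Lebesgue measure on triples of positive scales. -/
noncomputable def scaleMeasure : Measure (ℝ × ℝ × ℝ) :=
  (volume.restrict (Set.Ioi 0)).prod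
    ((volume.restrict (Set.Ioi 0)).prod (volume.restrict (Set.Ioi 0)))

instance : SFinite scaleMeasure := by
  unfold scaleMeasure
  infer_instance

theorem ae_scaleMeasure_pos : ∀ᵐ w ∂scaleMeasure, 0 < w.1 ∧ 0 < w.2.1 ∧ 0 < w.2.2 := by
  rw [scaleMeasure, Measure.prod_restrict, Measure.prod_restrict]
  filter_upwards [ae_restrict_mem
    (measurableSet_Ioi.prod (measurableSet_Ioi.prod measurableSet_Ioi))]
    with w hw
  exact ⟨hw.1, hw.2.1, hw.2.2⟩

/-- A frequency localized Gaussian symbol at scales `w = (r, ρ, t)`. -/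
noncomputable def scaleSymbol {d : ℕ} (m : ℕ) (a : ℝ) (w : ℝ × ℝ × ℝ)
    (z : EuclideanSpace ℝ (Fin d) × EuclideanSpace ℝ (Fin d)) : ℂ :=
  ((‖z.1 + z.2‖ ^ (2 * m) * gaussSymbol a w.2.2 w.1 w.2.1 z : ℝ) : ℂ)

section

variable {d m : ℕ} {a α β γ : ℝ}

/-- The normalising constant in the Gaussian superposition. -/
noncomputable def scaleConst (σ₁ σ₂ σ₃ : ℝ) : ℝ :=
  Real.Gamma (σ₁ / 2) / 2 * (Real.Gamma (σ₂ / 2) / 2 * (Real.Gamma (σ₃ / 2) / 2))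

theorem scaleConst_pos {σ₁ σ₂ σ₃ : ℝ} (h₁ : 0 < σ₁) (h₂ : 0 < σ₂) (h₃ : 0 < σ₃) :
    0 < scaleConst σ₁ σ₂ σ₃ := by
  have := Real.Gamma_pos_of_pos (half_pos h₁)
  have := Real.Gamma_pos_of_pos (half_pos h₂)
  have := Real.Gamma_pos_of_pos (half_pos h₃)
  unfold scaleConst
  positivity

theorem integral_scaleWeight_mul_symbol (hα : 0 < α) (hβ : 0 < β) (hγ : γ < 2 * m)
    {z : EuclideanSpace ℝ (Fin d) × EuclideanSpace ℝ (Fin d)}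
    (hz₁ : z.1 ≠ 0) (hz₂ : z.2 ≠ 0) (hz : z.1 + z.2 ≠ 0) :
    ∫ w, scaleWeight α β (2 * m - γ) w * (‖z.1 + z.2‖ ^ (2 * m) * gaussSymbol a w.2.2 w.1 w.2.1 z *
      (gevSymbol a α z.1 * gevSymbol a β z.2)) ∂scaleMeasure =
      scaleConst α β (2 * m - γ) * gevSymbol a γ (z.1 + z.2) := by
  have h := integral_scaleWeight_mul_gaussSymbol a hα hβ (by linarith : 0 < 2 * m - γ) hz₁ hz₂ hz
  have e : ∀ w : ℝ × ℝ × ℝ, scaleWeight α β (2 * m - γ) w *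
      (‖z.1 + z.2‖ ^ (2 * m) * gaussSymbol a w.2.2 w.1 w.2.1 z *
      (gevSymbol a α z.1 * gevSymbol a β z.2)) = (‖z.1 + z.2‖ ^ (2 * m) *
      (gevSymbol a α z.1 * gevSymbol a β z.2)) *
      (scaleWeight α β (2 * m - γ) w * gaussSymbol a w.2.2 w.1 w.2.1 z) := fun w => by ring
  rw [funext e, integral_const_mul, scaleMeasure, h]
  have p₁ : ‖z.1‖ ^ (-α) * ‖z.1‖ ^ α = 1 := by
    rw [← Real.rpow_add (norm_pos_iff.2 hz₁), neg_add_cancel, Real.rpow_zero]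
  have p₂ : ‖z.2‖ ^ (-β) * ‖z.2‖ ^ β = 1 := by
    rw [← Real.rpow_add (norm_pos_iff.2 hz₂), neg_add_cancel, Real.rpow_zero]
  have p₃ : ‖z.1 + z.2‖ ^ (-(2 * m - γ)) * ‖z.1 + z.2‖ ^ (2 * m) = ‖z.1 + z.2‖ ^ γ := by
    rw [← Real.rpow_natCast, ← Real.rpow_add (norm_pos_iff.2 hz)]
    congr 1
    push_cast
    ring
  have p₄ : Real.exp (a * (∑ i, |z.1 i + z.2 i| - ∑ i, |z.1 i| - ∑ i, |z.2 i|)) *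
      (Real.exp (a * ∑ i, |z.1 i|) * Real.exp (a * ∑ i, |z.2 i|)) =
      Real.exp (a * ∑ i, |z.1 i + z.2 i|) := by
    rw [← Real.exp_add, ← Real.exp_add]
    congr 1
    ring
  have p₅ : gevSymbol a γ (z.1 + z.2) =
      Real.exp (a * ∑ i, |z.1 i + z.2 i|) * ‖z.1 + z.2‖ ^ γ := by
    simp only [gevSymbol, PiLp.add_apply]
  rw [p₅, ← p₄, ← p₃, gevSymbol, gevSymbol, scaleConst]
  linear_combination (Real.Gamma (α / 2) / 2 * (Real.Gamma (β / 2) / 2 *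
    (Real.Gamma ((2 * m - γ) / 2) / 2))) *
      Real.exp (a * (∑ i, |z.1 i + z.2 i| - ∑ i, |z.1 i| - ∑ i, |z.2 i|)) *
      (Real.exp (a * ∑ i, |z.1 i|) * Real.exp (a * ∑ i, |z.2 i|)) *
      (‖z.1 + z.2‖ ^ (-(2 * m - γ)) * ‖z.1 + z.2‖ ^ (2 * m)) *
      (‖z.2‖ ^ (-β) * ‖z.2‖ ^ β * p₁ + p₂)

theorem integrable_scaleWeight_mul_symbol (hα : 0 < α) (hβ : 0 < β) (hγ : γ < 2 * m)
    {z : EuclideanSpace ℝ (Fin d) × EuclideanSpace ℝ (Fin d)}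
    (hz₁ : z.1 ≠ 0) (hz₂ : z.2 ≠ 0) (hz : z.1 + z.2 ≠ 0) :
    Integrable (fun w => scaleWeight α β (2 * m - γ) w *
      (‖z.1 + z.2‖ ^ (2 * m) * gaussSymbol a w.2.2 w.1 w.2.1 z *
      (gevSymbol a α z.1 * gevSymbol a β z.2))) scaleMeasure := by
  have h := integrable_scaleWeight_mul_gaussSymbol a hα hβ (by linarith : 0 < 2 * m - γ) hz₁ hz₂ hz
  refine (h.const_mul (‖z.1 + z.2‖ ^ (2 * m) *
    (gevSymbol a α z.1 * gevSymbol a β z.2))).congr (ae_of_all _ fun w => ?_)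
  dsimp only
  ring

theorem measurable_scaleWeight {σ₁ σ₂ σ₃ : ℝ} : Measurable (scaleWeight σ₁ σ₂ σ₃) := by
  unfold scaleWeight
  fun_prop

theorem continuous_gaussSymbol : Continuous
    fun u : (EuclideanSpace ℝ (Fin d) × EuclideanSpace ℝ (Fin d)) × ℝ × ℝ × ℝ =>
      gaussSymbol a u.2.2.2 u.2.1 u.2.2.1 u.1 := by
  unfold gaussSymbol
  fun_prop

end

section

variable {d m : ℕ} {a α β γ : ℝ}

theorem gaussSymbol_nonneg {t r ρ : ℝ}
    (z : EuclideanSpace ℝ (Fin d) × EuclideanSpace ℝ (Fin d)) : 0 ≤ gaussSymbol a t r ρ z :=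
  Finset.prod_nonneg fun _ _ => (Real.exp_pos _).le

theorem gevSymbol_nonneg (ξ : EuclideanSpace ℝ (Fin d)) : 0 ≤ gevSymbol a α ξ := by
  unfold gevSymbol
  positivity

theorem scaleWeight_nonneg {σ₁ σ₂ σ₃ : ℝ} {w : ℝ × ℝ × ℝ}
    (hw : 0 < w.1 ∧ 0 < w.2.1 ∧ 0 < w.2.2) : 0 ≤ scaleWeight σ₁ σ₂ σ₃ w := by
  obtain ⟨h₁, h₂, h₃⟩ := hw
  unfold scaleWeight
  positivity

theorem integrable_scale_superposition (hd : 1 ≤ d) (hα : 0 < α) (hβ : 0 < β) (hγ : 0 < γ)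
    (hm : γ < 2 * m) (f g : SchwartzMap (EuclideanSpace ℝ (Fin d)) ℂ)
    (hf : HasCompactSupport (𝓕 ⇑f)) (hg : HasCompactSupport (𝓕 ⇑g))
    (x : EuclideanSpace ℝ (Fin d)) :
    Integrable (fun u : (EuclideanSpace ℝ (Fin d) × EuclideanSpace ℝ (Fin d)) × ℝ × ℝ × ℝ =>
      ((scaleWeight α β (2 * m - γ) u.2 * (‖u.1.1 + u.1.2‖ ^ (2 * m) *
        gaussSymbol a u.2.2.2 u.2.1 u.2.2.1 u.1 *
        (gevSymbol a α u.1.1 * gevSymbol a β u.1.2)) : ℝ) : ℂ) *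
        (Complex.exp ((2 * Real.pi * ⟪u.1.1 + u.1.2, x⟫ : ℝ) * Complex.I) *
          (𝓕 (⇑f) u.1.1 * 𝓕 (⇑g) u.1.2))) (volume.prod scaleMeasure) := by
  have hA := continuous_gevSymbol (d := d) (a := a) hα
  have hB := continuous_gevSymbol (d := d) (a := a) hβ
  have hf' := continuous_fourier_schwartz f
  have hg' := continuous_fourier_schwartz g
  have hs := continuous_gaussSymbol (d := d) (a := a)
  have hw := measurable_scaleWeight (σ₁ := α) (σ₂ := β) (σ₃ := 2 * m - γ)
  have hmeas : Measurable
      fun u : (EuclideanSpace ℝ (Fin d) × EuclideanSpace ℝ (Fin d)) × ℝ × ℝ × ℝ =>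
      ((scaleWeight α β (2 * m - γ) u.2 * (‖u.1.1 + u.1.2‖ ^ (2 * m) *
        gaussSymbol a u.2.2.2 u.2.1 u.2.2.1 u.1 *
        (gevSymbol a α u.1.1 * gevSymbol a β u.1.2)) : ℝ) : ℂ) *
        (Complex.exp ((2 * Real.pi * ⟪u.1.1 + u.1.2, x⟫ : ℝ) * Complex.I) *
          (𝓕 (⇑f) u.1.1 * 𝓕 (⇑g) u.1.2)) := by
    refine Measurable.mul (Complex.measurable_ofReal.comp ?_) (Continuous.measurable (by fun_prop))
    refine Measurable.mul (hw.comp measurable_snd) (Continuous.measurable ?_)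
    exact Continuous.mul (Continuous.mul (by fun_prop) hs) (by fun_prop)
  refine (integrable_prod_iff hmeas.aestronglyMeasurable).2 ⟨?_, ?_⟩
  · filter_upwards [ae_ne_zero_and_ne_zero_and_add_ne_zero hd] with z hz
    exact (integrable_scaleWeight_mul_symbol hα hβ hm hz.1 hz.2.1 hz.2.2).ofReal.mul_const _
  · refine ((integrable_gev_mul (a := a) hγ f g hf hg x).norm.const_mul
      (scaleConst α β (2 * m - γ))).congr ?_
    filter_upwards [ae_ne_zero_and_ne_zero_and_add_ne_zero hd] with z hz
    have e := integral_scaleWeight_mul_symbol (a := a) hα hβ hm hz.1 hz.2.1 hz.2.2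
    have h : ∀ᵐ w ∂scaleMeasure, ‖((scaleWeight α β (2 * m - γ) w * (‖z.1 + z.2‖ ^ (2 * m) *
        gaussSymbol a w.2.2 w.1 w.2.1 z *
        (gevSymbol a α z.1 * gevSymbol a β z.2)) : ℝ) : ℂ) *
        (Complex.exp ((2 * Real.pi * ⟪z.1 + z.2, x⟫ : ℝ) * Complex.I) *
          (𝓕 (⇑f) z.1 * 𝓕 (⇑g) z.2))‖ = scaleWeight α β (2 * m - γ) w * (‖z.1 + z.2‖ ^ (2 * m) *
        gaussSymbol a w.2.2 w.1 w.2.1 z *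
        (gevSymbol a α z.1 * gevSymbol a β z.2)) * ‖𝓕 (⇑f) z.1 * 𝓕 (⇑g) z.2‖ := by
      filter_upwards [ae_scaleMeasure_pos] with w hw
      have h₁ := scaleWeight_nonneg (σ₁ := α) (σ₂ := β) (σ₃ := 2 * m - γ) hw
      have h₂ := gaussSymbol_nonneg (a := a) (t := w.2.2) (r := w.1) (ρ := w.2.1) z
      have h₃ := gevSymbol_nonneg (a := a) (α := α) z.1
      have h₄ := gevSymbol_nonneg (a := a) (α := β) z.2
      rw [norm_mul, norm_mul (Complex.exp _), norm_cexp_mul_I, one_mul, Complex.norm_real,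
        Real.norm_of_nonneg (by positivity)]
    rw [integral_congr_ae h, integral_mul_const, e, norm_mul, norm_mul (Complex.exp _),
      norm_cexp_mul_I, one_mul, Complex.norm_real, Real.norm_of_nonneg (gevSymbol_nonneg _),
      mul_assoc]

theorem scaleConst_mul_gev_mul (hd : 1 ≤ d) (hα : 0 < α) (hβ : 0 < β) (hγ : 0 < γ)
    (hm : γ < 2 * m) (f g : SchwartzMap (EuclideanSpace ℝ (Fin d)) ℂ)
    (hf : HasCompactSupport (𝓕 ⇑f)) (hg : HasCompactSupport (𝓕 ⇑g))
    (x : EuclideanSpace ℝ (Fin d)) :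
    (scaleConst α β (2 * m - γ) : ℂ) * gev d a γ (fun y => f y * g y) x =
      ∫ w, (scaleWeight α β (2 * m - γ) w : ℂ) * bilinMul (scaleSymbol m a w)
        (fun ξ => (gevSymbol a α ξ : ℂ) * 𝓕 (⇑f) ξ) (fun ξ => (gevSymbol a β ξ : ℂ) * 𝓕 (⇑g) ξ) x
        ∂scaleMeasure := by
  have hswap := integral_integral_swap
    (f := fun (z : EuclideanSpace ℝ (Fin d) × EuclideanSpace ℝ (Fin d)) (w : ℝ × ℝ × ℝ) =>
      ((scaleWeight α β (2 * m - γ) w * (‖z.1 + z.2‖ ^ (2 * m) *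
        gaussSymbol a w.2.2 w.1 w.2.1 z *
        (gevSymbol a α z.1 * gevSymbol a β z.2)) : ℝ) : ℂ) *
        (Complex.exp ((2 * Real.pi * ⟪z.1 + z.2, x⟫ : ℝ) * Complex.I) *
          (𝓕 (⇑f) z.1 * 𝓕 (⇑g) z.2)))
    (integrable_scale_superposition hd hα hβ hγ hm f g hf hg x)
  rw [gev_mul_eq_integral hγ f g hf hg x, ← integral_const_mul]
  refine Eq.trans (integral_congr_ae ?_) (hswap.trans (integral_congr_ae ?_))
  · filter_upwards [ae_ne_zero_and_ne_zero_and_add_ne_zero hd] with z hz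
    have e := integral_scaleWeight_mul_symbol (a := a) hα hβ hm hz.1 hz.2.1 hz.2.2
    rw [integral_mul_const, integral_complex_ofReal, e]
    push_cast
    ring
  · refine ae_of_all _ fun w => ?_
    dsimp only
    rw [bilinMul, ← integral_const_mul]
    refine integral_congr_ae (ae_of_all _ fun z => ?_)
    simp only [scaleSymbol]
    push_cast
    ring

theorem measurable_cauchyConv {F G : EuclideanSpace ℝ (Fin d) → ℝ≥0∞} (hF : Measurable F)
    (hG : Measurable G) (x : EuclideanSpace ℝ (Fin d)) :
    Measurable fun w : ℝ × ℝ × ℝ => cauchyConv w.2.2 w.1 w.2.1 F G x := by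
  have h₁ : Measurable fun u : (ℝ × ℝ × ℝ) × EuclideanSpace ℝ (Fin d) =>
      posConv (prodCauchy u.1.1) F u.2 := by
    have h : Measurable fun u : (ℝ × ℝ × ℝ) × EuclideanSpace ℝ (Fin d) => (u.1.1, u.2) := by
      fun_prop
    have h' := (measurable_posConv_prodCauchy hF).comp h
    exact h'
  have h₂ : Measurable fun u : (ℝ × ℝ × ℝ) × EuclideanSpace ℝ (Fin d) =>
      posConv (prodCauchy u.1.2.1) G u.2 := by
    have h : Measurable fun u : (ℝ × ℝ × ℝ) × EuclideanSpace ℝ (Fin d) => (u.1.2.1, u.2) := by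
      fun_prop
    have h' := (measurable_posConv_prodCauchy hG).comp h
    exact h'
  have h₀ : Measurable fun u : (ℝ × ℝ × ℝ) × EuclideanSpace ℝ (Fin d) =>
      prodCauchy u.1.2.2 (x - u.2) := by
    unfold prodCauchy
    fun_prop
  have h := (h₀.mul (h₁.mul h₂)).lintegral_prod_right' (ν := volume)
  exact h

/-- Pointwise domination of `gev d a γ (fg)` by positive bilinear operators, uniformly in `a`. -/
theorem enorm_gev_mul_le (hd : 1 ≤ d) (hα : 0 < α) (hβ : 0 < β) (hγ : 0 < γ) {ε : ℝ} (hε : 0 < ε)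
    (hεα : γ + ε < α) (hεβ : γ + ε < β) (hα' : α < d) (hβ' : β < d) (hε' : ε < d) :
    ∃ C : ℝ, 0 < C ∧ ∀ a : ℝ, 0 ≤ a → ∀ f g : SchwartzMap (EuclideanSpace ℝ (Fin d)) ℂ,
      HasCompactSupport (𝓕 ⇑f) → HasCompactSupport (𝓕 ⇑g) → ∀ x,
      ‖gev d a γ (fun y => f y * g y) x‖ₑ ≤ ENNReal.ofReal C *
        (posConv (prodRiesz (ε / d)) (fun y =>
          posConv (prodRiesz ((α - γ - ε) / d)) (fun y => ‖gev d a α f y‖ₑ) y *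
          posConv (prodRiesz (β / d)) (fun y => ‖gev d a β g y‖ₑ) y) x +
        posConv (prodRiesz (ε / d)) (fun y =>
          posConv (prodRiesz (α / d)) (fun y => ‖gev d a α f y‖ₑ) y *
          posConv (prodRiesz ((β - γ - ε) / d)) (fun y => ‖gev d a β g y‖ₑ) y) x) := by
  have hd0 : (0 : ℝ) < d := by exact_mod_cast hd
  obtain ⟨m, hm⟩ := exists_nat_gt (γ + ε)
  have hs : γ + ε ≤ 2 * m := by
    have : (0 : ℝ) ≤ m := m.cast_nonneg
    linarith
  have hm' : γ < 2 * m := by linarith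
  set K := scaleConst α β (2 * m - γ) with hK
  have hK0 : 0 < K := scaleConst_pos hα hβ (by linarith)
  obtain ⟨A, hA, hS⟩ := exists_symbolBound_gaussSymbol (d := d) (m := m)
    (by linarith : 0 < γ + ε) hs
  have dpos : ∀ {σ : ℝ}, 0 < σ → 0 < σ / d := fun h => div_pos h hd0
  have dlt : ∀ {σ : ℝ}, σ < d → σ / d < 1 := fun h => (div_lt_one hd0).2 h
  have dmul : ∀ σ : ℝ, d * (σ / d) = σ := fun σ => mul_div_cancel₀ σ hd0.ne'
  obtain ⟨C₁, hC₁, h₁⟩ := lintegral_rpow_mul_cauchyConv_le (dpos hε) (dlt hε')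
    (dpos (by linarith : 0 < α - γ - ε)) (dlt (by linarith)) (dpos hβ) (dlt hβ') hd
  obtain ⟨C₂, hC₂, h₂⟩ := lintegral_rpow_mul_cauchyConv_le (dpos hε) (dlt hε')
    (dpos hα) (dlt hα') (dpos (by linarith : 0 < β - γ - ε)) (dlt (by linarith)) hd
  simp only [dmul] at h₁ h₂
  refine ⟨K⁻¹ * (A * max C₁ C₂), by positivity, fun a ha f g hf hg x => ?_⟩
  set F : EuclideanSpace ℝ (Fin d) → ℝ≥0∞ := fun y => ‖gev d a α f y‖ₑ with hF
  set G : EuclideanSpace ℝ (Fin d) → ℝ≥0∞ := fun y => ‖gev d a β g y‖ₑ with hG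
  have iφ := integrable_gevSymbol_mul (a := a) hα f hf
  have iψ := integrable_gevSymbol_mul (a := a) hβ g hg
  have hFe : F = fun y => ‖𝓕⁻ (fun ξ => (gevSymbol a α ξ : ℂ) * 𝓕 (⇑f) ξ) y‖ₑ := by
    rw [hF, gev_eq_fourierInv]
  have hGe : G = fun y => ‖𝓕⁻ (fun ξ => (gevSymbol a β ξ : ℂ) * 𝓕 (⇑g) ξ) y‖ₑ := by
    rw [hG, gev_eq_fourierInv]
  have mF : Measurable F := hFe ▸ measurable_enorm_fourierInv iφ
  have mG : Measurable G := hGe ▸ measurable_enorm_fourierInv iψ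
  have hbound : ∀ᵐ w ∂scaleMeasure, ‖(scaleWeight α β (2 * m - γ) w : ℂ) *
      bilinMul (scaleSymbol m a w) (fun ξ => (gevSymbol a α ξ : ℂ) * 𝓕 (⇑f) ξ)
        (fun ξ => (gevSymbol a β ξ : ℂ) * 𝓕 (⇑g) ξ) x‖ₑ ≤ ENNReal.ofReal A *
      (ENNReal.ofReal (w.1 ^ (α - γ - ε - 1)) * (ENNReal.ofReal (w.2.1 ^ (β - 1)) *
        (ENNReal.ofReal (w.2.2 ^ (ε - 1)) * cauchyConv w.2.2 w.1 w.2.1 F G x)) +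
      ENNReal.ofReal (w.1 ^ (α - 1)) * (ENNReal.ofReal (w.2.1 ^ (β - γ - ε - 1)) *
        (ENNReal.ofReal (w.2.2 ^ (ε - 1)) * cauchyConv w.2.2 w.1 w.2.1 F G x))) := by
    filter_upwards [ae_scaleMeasure_pos] with w hw
    have hb := (hS a w.2.2 w.1 w.2.1 ha hw.2.2 hw.1 hw.2.1).enorm_le _ _ iφ iψ x
    rw [← hFe, ← hGe] at hb
    obtain ⟨hr, hρ, ht⟩ := hw
    have e : scaleWeight α β (2 * m - γ) w * (A * (w.2.2 ^ (γ + ε - 2 * m) *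
        (w.1 ^ (-(γ + ε)) + w.2.1 ^ (-(γ + ε))))) =
        A * (w.1 ^ (α - γ - ε - 1) * (w.2.1 ^ (β - 1) * w.2.2 ^ (ε - 1)) +
          w.1 ^ (α - 1) * (w.2.1 ^ (β - γ - ε - 1) * w.2.2 ^ (ε - 1))) := by
      rw [show ε - 1 = (2 * m - γ - 1) + (γ + ε - 2 * m) by ring, Real.rpow_add ht,
        show α - γ - ε - 1 = (α - 1) + (-(γ + ε)) by ring, Real.rpow_add hr,
        show β - γ - ε - 1 = (β - 1) + (-(γ + ε)) by ring, Real.rpow_add hρ, scaleWeight]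
      ring
    have hw0 : 0 ≤ scaleWeight α β (2 * m - γ) w := scaleWeight_nonneg ⟨hr, hρ, ht⟩
    calc _ ≤ ENNReal.ofReal (scaleWeight α β (2 * m - γ) w) * (ENNReal.ofReal
          (A * (w.2.2 ^ (γ + ε - 2 * m) * (w.1 ^ (-(γ + ε)) + w.2.1 ^ (-(γ + ε))))) *
          cauchyConv w.2.2 w.1 w.2.1 F G x) := by
          rw [enorm_mul, ← ofReal_norm ((scaleWeight _ _ _ _ : ℝ) : ℂ), Complex.norm_real,
            Real.norm_of_nonneg hw0]
          gcongr
          exact hb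
      _ = _ := by
          rw [← mul_assoc, ← ENNReal.ofReal_mul hw0, e, ENNReal.ofReal_mul hA.le,
            ENNReal.ofReal_add (by positivity) (by positivity), ENNReal.ofReal_mul (by positivity),
            ENNReal.ofReal_mul (by positivity), ENNReal.ofReal_mul (by positivity),
            ENNReal.ofReal_mul (by positivity)]
          ring
  have mC := measurable_cauchyConv mF mG x
  have key : ‖(K : ℂ) * gev d a γ (fun y => f y * g y) x‖ₑ ≤ ENNReal.ofReal A *
      ((ENNReal.ofReal C₁ * posConv (prodRiesz (ε / d)) (fun y =>
          posConv (prodRiesz ((α - γ - ε) / d)) F y * posConv (prodRiesz (β / d)) G y) x) +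
        ENNReal.ofReal C₂ * posConv (prodRiesz (ε / d)) (fun y =>
          posConv (prodRiesz (α / d)) F y * posConv (prodRiesz ((β - γ - ε) / d)) G y) x) := by
    rw [hK, scaleConst_mul_gev_mul hd hα hβ hγ hm' f g hf hg x]
    refine (enorm_integral_le_lintegral_enorm _).trans ((lintegral_mono_ae hbound).trans ?_)
    rw [lintegral_const_mul' _ _ ENNReal.ofReal_ne_top, lintegral_add_left (by fun_prop)]
    gcongr
    · refine le_trans ?_ (h₁ F G mF mG x)
      exact (lintegral_prod_le _).trans (lintegral_mono fun r => lintegral_prod_le _)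
    · refine le_trans ?_ (h₂ F G mF mG x)
      exact (lintegral_prod_le _).trans (lintegral_mono fun r => lintegral_prod_le _)
  have hK1 : ENNReal.ofReal K⁻¹ * ENNReal.ofReal K = 1 := by
    rw [← ENNReal.ofReal_mul (by positivity), inv_mul_cancel₀ hK0.ne', ENNReal.ofReal_one]
  have hKe : ‖(K : ℂ)‖ₑ = ENNReal.ofReal K := by
    rw [← ofReal_norm, Complex.norm_real, Real.norm_of_nonneg hK0.le]
  rw [enorm_mul, hKe] at key
  rw [← one_mul ‖gev d a γ _ x‖ₑ, ← hK1, mul_assoc, ENNReal.ofReal_mul (by positivity),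
    ENNReal.ofReal_mul hA.le, mul_assoc, mul_assoc]
  refine mul_le_mul_right (key.trans (mul_le_mul_right ?_ _)) _
  rw [mul_add]
  gcongr
  · exact le_max_left _ _
  · exact le_max_right _ _

end

theorem lintegral_prodRiesz_bilinear_le {p s₀ s₁ s₂ : ℝ} (d : ℕ) (hp : 1 < p) (h₀ : 0 < s₀)
    (h₁ : 0 < s₁) (h₂ : 0 < s₂) (h₁' : s₁ < 1 / p) (h₂' : s₂ < 1 / p) (h₀' : 1 / p + s₀ < 1)
    (hs : s₀ + s₁ + s₂ = 1 / p) :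
    ∃ C : ℝ, 0 < C ∧ ∀ F G : EuclideanSpace ℝ (Fin d) → ℝ≥0∞, Measurable F → Measurable G →
      (∫⁻ x, posConv (prodRiesz s₀)
        (fun y => posConv (prodRiesz s₁) F y * posConv (prodRiesz s₂) G y) x ^ p) ^ (1 / p) ≤
        ENNReal.ofReal C * ((∫⁻ x, F x ^ p) ^ (1 / p) * (∫⁻ x, G x ^ p) ^ (1 / p)) := by
  have hp0 : 0 < p := by linarith
  have hip : 0 < 1 / p := by positivity
  have hq₀ : 1 < 1 / (1 / p + s₀) := one_lt_one_div (by positivity) h₀'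
  obtain ⟨C₀, hC₀, H₀⟩ := lintegral_posConv_prodRiesz_le (q := p) (s := s₀) d hq₀ hp0 h₀
    (by rw [one_div_one_div]; ring)
  obtain ⟨C₁, hC₁, H₁⟩ := lintegral_posConv_prodRiesz_le (q := 1 / (1 / p - s₁)) d hp
    (one_div_pos.2 (sub_pos.2 h₁')) h₁ (by rw [one_div_one_div])
  obtain ⟨C₂, hC₂, H₂⟩ := lintegral_posConv_prodRiesz_le (q := 1 / (1 / p - s₂)) d hp
    (one_div_pos.2 (sub_pos.2 h₂')) h₂ (by rw [one_div_one_div])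
  refine ⟨C₀ * (C₁ * C₂), by positivity, fun F G hF hG => ?_⟩
  have mF := measurable_posConv (measurable_prodRiesz s₁) hF
  have mG := measurable_posConv (measurable_prodRiesz s₂) hG
  have holder := ENNReal.lintegral_Lp_mul_le_Lq_mul_Lr (p := 1 / (1 / p + s₀))
    (q := 1 / (1 / p - s₁)) (r := 1 / (1 / p - s₂)) (by positivity)
    (one_div_lt_one_div_of_lt (sub_pos.2 h₁') (by linarith))
    (by simp only [one_div_one_div]; linarith) volume mF.aemeasurable mG.aemeasurable
  refine (H₀ _ (mF.mul mG)).trans ?_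
  calc _ ≤ ENNReal.ofReal C₀ * ((ENNReal.ofReal C₁ * (∫⁻ x, F x ^ p) ^ (1 / p)) *
        (ENNReal.ofReal C₂ * (∫⁻ x, G x ^ p) ^ (1 / p))) := by
        gcongr
        exact holder.trans (mul_le_mul' (H₁ F hF) (H₂ G hG))
    _ = _ := by
        rw [ENNReal.ofReal_mul hC₀.le, ENNReal.ofReal_mul hC₁.le]
        ring

/-- Lemma 2.7, product estimate in Gevrey–Sobolev spaces: for
`1 < p < ∞`, `0 < α, β < d/p` with `α + β > d/p` and `γ = α + β − d/p`, there is `C`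
independent of `a ≥ 0` such that for all Schwartz `f, g` with compactly supported
Fourier transforms: `‖G_{a,γ}(fg)‖_{L^p} ≤ C ‖G_{a,α}f‖_{L^p} ‖G_{a,β}g‖_{L^p}`. -/
theorem stmt11 (d : ℕ) (hd : 1 ≤ d) (p α β : ℝ) (hp : 1 < p)
    (hα : 0 < α) (hα' : α < d / p) (hβ : 0 < β) (hβ' : β < d / p)
    (hαβ : d / p < α + β) :
    ∃ C : ℝ, 0 < C ∧
      ∀ a : ℝ, 0 ≤ a →
        ∀ f g : SchwartzMap (EuclideanSpace ℝ (Fin d)) ℂ,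
          HasCompactSupport (𝓕 ⇑f) → HasCompactSupport (𝓕 ⇑g) →
          eLpNorm (gev d a (α + β - d / p) fun x => f x * g x) (ENNReal.ofReal p) volume ≤
            ENNReal.ofReal C *
              (eLpNorm (gev d a α ⇑f) (ENNReal.ofReal p) volume *
                eLpNorm (gev d a β ⇑g) (ENNReal.ofReal p) volume) := by
  have hd0 : (0 : ℝ) < d := by exact_mod_cast hd
  have hp0 : 0 < p := by linarith
  have hip : 1 / p < 1 := (div_lt_one hp0).2 hp
  have hdp : (d : ℝ) / p < d := div_lt_self hd0 hp
  have hdp' : (d : ℝ) / p / d = 1 / p := by field_simp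
  set γ := α + β - d / p with hγ
  obtain ⟨ε, hε, hε'⟩ := exists_between
    (lt_min (sub_pos.2 hα') (lt_min (sub_pos.2 hβ') (sub_pos.2 hdp)))
  simp only [lt_min_iff] at hε'
  obtain ⟨hεα, hεβ, hεd⟩ := hε'
  have hdiv : ∀ {σ : ℝ}, σ < d / p → σ / d < 1 / p := fun h => by
    rw [← hdp']
    exact div_lt_div_of_pos_right h hd0
  have hε₁ : 1 / p + ε / d < 1 := by
    have : (d / p + ε) / d < 1 := (div_lt_one hd0).2 (by linarith)
    rwa [add_div, hdp'] at this
  obtain ⟨C, hC, hpt⟩ := enorm_gev_mul_le hd hα hβ (by linarith : 0 < γ) hε (by linarith)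
    (by linarith) (hα'.trans hdp) (hβ'.trans hdp)
    (by linarith [div_pos hd0 hp0])
  obtain ⟨C₁, hC₁, H₁⟩ := lintegral_prodRiesz_bilinear_le d hp (div_pos hε hd0)
    (div_pos (by linarith : 0 < α - γ - ε) hd0) (div_pos hβ hd0) (hdiv (by linarith))
    (hdiv hβ') hε₁ (by rw [← add_div, ← add_div, ← hdp']; congr 1; rw [hγ]; ring)
  obtain ⟨C₂, hC₂, H₂⟩ := lintegral_prodRiesz_bilinear_le d hp (div_pos hε hd0)
    (div_pos hα hd0) (div_pos (by linarith : 0 < β - γ - ε) hd0) (hdiv hα') (hdiv (by linarith))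
    hε₁ (by rw [← add_div, ← add_div, ← hdp']; congr 1; rw [hγ]; ring)
  refine ⟨C * (C₁ + C₂), by positivity, fun a ha f g hf hg => ?_⟩
  have hLp : ∀ u : EuclideanSpace ℝ (Fin d) → ℂ, eLpNorm u (ENNReal.ofReal p) volume =
      (∫⁻ x, ‖u x‖ₑ ^ p) ^ (1 / p) := fun u => by
    rw [eLpNorm_eq_lintegral_rpow_enorm_toReal (by simpa using hp0) ENNReal.ofReal_ne_top,
      ENNReal.toReal_ofReal hp0.le]
  have mF : Measurable fun y => ‖gev d a α f y‖ₑ := by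
    rw [gev_eq_fourierInv]
    exact measurable_enorm_fourierInv (integrable_gevSymbol_mul hα f hf)
  have mG : Measurable fun y => ‖gev d a β g y‖ₑ := by
    rw [gev_eq_fourierInv]
    exact measurable_enorm_fourierInv (integrable_gevSymbol_mul hβ g hg)
  have hT : ∀ s₀ s₁ s₂ : ℝ, Measurable (posConv (prodRiesz s₀) (fun y =>
      posConv (prodRiesz s₁) (fun y => ‖gev d a α f y‖ₑ) y *
      posConv (prodRiesz s₂) (fun y => ‖gev d a β g y‖ₑ) y)) := fun s₀ s₁ s₂ =>
    measurable_posConv (measurable_prodRiesz s₀)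
      ((measurable_posConv (measurable_prodRiesz s₁) mF).mul
        (measurable_posConv (measurable_prodRiesz s₂) mG))
  rw [hLp, hLp, hLp]
  refine (ENNReal.rpow_le_rpow (lintegral_mono fun x =>
    ENNReal.rpow_le_rpow (hpt a ha f g hf hg x) hp0.le) (by positivity)).trans ?_
  simp_rw [ENNReal.mul_rpow_of_nonneg _ _ hp0.le]
  rw [lintegral_const_mul' _ _ (ENNReal.rpow_ne_top_of_nonneg hp0.le ENNReal.ofReal_ne_top),
    ENNReal.mul_rpow_of_nonneg _ _ (by positivity), ← ENNReal.rpow_mul, mul_one_div_cancel hp0.ne',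
    ENNReal.rpow_one, ENNReal.ofReal_mul hC.le, mul_assoc, ENNReal.ofReal_add hC₁.le hC₂.le,
    add_mul]
  refine mul_le_mul_right ((ENNReal.lintegral_Lp_add_le (hT _ _ _).aemeasurable
    (hT _ _ _).aemeasurable hp.le).trans ?_) _
  exact add_le_add (H₁ _ _ mF mG) (H₂ _ _ mF mG)
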